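/- arXiv:2505.05902 — 3 statements merged into one kernel-verified Lean document; each statement's English description precedes it below -/
import Mathlib

section
/- For every integer n ≥ 4, the group G = T4(n) of order 3^n satisfies S(G) = 10 + 2·3^{n−2}, where S(G) = Σ_C log₃ |C_G(g_C)/Frat(C_G(g_C))|, the sum running over the conjugacy classes C of G with g_C ∈ C an arbitrary representative (the summand does not depend on the choice of representative). -/
/-- The commutator `[x,y] = x⁻¹y⁻¹xy`. -/
def gpComm {G : Type*} [Group G] (x y : G) : G := x⁻¹ * y⁻¹ * x * y

namespace MaxClass3

/-- The free generators `a`, `b`, `c`, `d`. -/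
abbrev a : FreeGroup (Fin 4) := FreeGroup.of 0
abbrev b : FreeGroup (Fin 4) := FreeGroup.of 1
abbrev c : FreeGroup (Fin 4) := FreeGroup.of 2
abbrev d : FreeGroup (Fin 4) := FreeGroup.of 3

/-- The word representing the central element `z`. -/
def zWord (n : ℕ) : FreeGroup (Fin 4) :=
  if Even n then d ^ ((-3 : ℤ) ^ ((n - 4) / 2)) else c ^ ((-3 : ℤ) ^ ((n - 3) / 2))

/-- Relators of the group `𝒦(n)`: `c = [b,a]`, `d = [c,a]`, `[d,a] = c⁻³d⁻³`,
`[d,b] = [d,c] = 1`, together with the exponent relations depending on the parity of `n`. -/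
def Krels (n : ℕ) : Set (FreeGroup (Fin 4)) :=
  {c⁻¹ * gpComm b a, d⁻¹ * gpComm c a, gpComm d a * d ^ 3 * c ^ 3, gpComm d b, gpComm d c} ∪
    (if Even n then {c ^ 3 ^ ((n - 2) / 2), d ^ 3 ^ ((n - 2) / 2)}
     else {c ^ 3 ^ ((n - 1) / 2), d ^ 3 ^ ((n - 3) / 2)})

/-- Relators of `T4(n)`: those of `𝒦(n)` together with `a³ = z`, `b³ = c⁻³d⁻¹`, `[c,b] = 1`. -/
def T4rels (n : ℕ) : Set (FreeGroup (Fin 4)) :=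
  Krels n ∪ {a ^ 3 * (zWord n)⁻¹, b ^ 3 * d * c ^ 3, gpComm c b}

/-- The group `T4(n)`. -/
abbrev T4 (n : ℕ) : Type := PresentedGroup (T4rels n)

end MaxClass3

/-- `S(G) = Σ_C log₃ |C_G(g_C)/Frat(C_G(g_C))|`, the sum over the conjugacy classes `C` of `G`
of the `3`-logarithm of the order of the Frattini quotient of the centralizer of a
representative of `C`. -/
noncomputable def SInvariant (G : Type*) [Group G] : ℕ :=
  ∑ᶠ C : ConjClasses G,
    Nat.log 3 (Nat.card
      (↥(Subgroup.centralizer {(ConjClasses.exists_rep C).choose}) ⧸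
        frattini ↥(Subgroup.centralizer {(ConjClasses.exists_rep C).choose})))

theorem isCoatom_of_index_eq_prime {P : Type*} [Group P] {p : ℕ} (hp : p.Prime) {M : Subgroup P}
    (hM : M.index = p) : IsCoatom M := by
  refine ⟨fun h => hp.ne_one (by rw [← hM, h, Subgroup.index_top]), fun K hK => ?_⟩
  have h := Subgroup.relIndex_mul_index hK.le
  rw [hM] at h
  rcases (Nat.dvd_prime hp).1 ⟨_, h.symm.trans (mul_comm _ _)⟩ with h1 | h1
  · exact Subgroup.index_eq_one.1 h1
  · rw [h1] at h
    have h2 : M.relIndex K = 1 := Nat.eq_of_mul_eq_mul_right hp.pos (by rw [h, one_mul])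
    exact absurd (Subgroup.relIndex_eq_one.1 h2) (not_le_of_gt hK)

namespace IsPGroup

variable {P : Type*} [Group P] {p : ℕ} [Fact p.Prime]

theorem normal_of_isCoatom [Finite P] (hP : IsPGroup p P) {M : Subgroup P}
    (hM : IsCoatom M) : M.Normal := by
  have : Group.IsNilpotent P := hP.isNilpotent
  exact Subgroup.NormalizerCondition.normal_of_coatom M Group.normalizerCondition_of_isNilpotent hM

theorem index_eq_of_isCoatom [Finite P] (hP : IsPGroup p P) {M : Subgroup P}
    (hM : IsCoatom M) :
    M.index = p := by
  have hp : p.Prime := Fact.out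
  obtain ⟨k, hk⟩ := IsPGroup.iff_card.1 (hP.to_subgroup M)
  obtain ⟨l, hl⟩ := hP.index M
  have hl0 : l ≠ 0 := by
    rintro rfl
    exact hM.1 (Subgroup.index_eq_one.1 (by simpa using hl))
  have hdvd : p ^ (k + 1) ∣ Nat.card P := by
    rw [← M.card_mul_index, hk, hl, ← pow_add]
    exact pow_dvd_pow _ (by omega)
  obtain ⟨K, hK, hMK⟩ := Sylow.exists_subgroup_card_pow_succ hdvd hk
  have hne : M ≠ K := by
    rintro rfl
    exact absurd (Nat.pow_right_injective hp.two_le (hk.symm.trans hK)) (by omega)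
  have htop := hM.2 K (lt_of_le_of_ne hMK hne)
  have h := M.card_mul_index
  rw [← Subgroup.card_top (G := P), ← htop, hK, hk, pow_succ] at h
  exact Nat.eq_of_mul_eq_mul_left (pow_pos hp.pos k) h

theorem pow_mem_of_isCoatom [Finite P] (hP : IsPGroup p P) {M : Subgroup P}
    (hM : IsCoatom M) (x : P) :
    x ^ p ∈ M := by
  have := hP.normal_of_isCoatom hM
  rw [← hP.index_eq_of_isCoatom hM]
  exact M.pow_index_mem x

theorem mul_mul_inv_mul_inv_mem_of_isCoatom [Finite P] (hP : IsPGroup p P) {M : Subgroup P}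
    (hM : IsCoatom M)
    (x y : P) : x * y * x⁻¹ * y⁻¹ ∈ M := by
  have := hP.normal_of_isCoatom hM
  have hc : Nat.card (P ⧸ M) = p := hP.index_eq_of_isCoatom hM
  have := isCyclic_of_prime_card hc
  have hcomm : (x : P ⧸ M) * y = y * x := IsMulCommutative.is_comm.comm _ _
  rw [← QuotientGroup.eq_one_iff]
  calc ((x * y * x⁻¹ * y⁻¹ : P) : P ⧸ M) = (x : P ⧸ M) * y * (x : P ⧸ M)⁻¹ * (y : P ⧸ M)⁻¹ := rfl
    _ = 1 := by rw [hcomm]; group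

/-- If `χ` is a homomorphism of a `p`-group onto a group `V` in which homomorphisms to
`ℤ/p` separate points from `1`, and the kernel of `χ` lies in all maximal subgroups, then `χ.ker`
is the Frattini subgroup. -/
theorem card_quotient_frattini {V : Type*} [Group V] (χ : P →* V) (hχ : Function.Surjective χ)
    (hV : ∀ v : V, v ≠ 1 → ∃ f : V →* Multiplicative (ZMod p), f v ≠ 1)
    (hker : ∀ M : Subgroup P, IsCoatom M → χ.ker ≤ M) :
    Nat.card (P ⧸ frattini P) = Nat.card V := by
  have hp : p.Prime := Fact.out
  have h : frattini P = χ.ker := by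
    refine le_antisymm (fun x hx => ?_) (le_iInf₂ hker)
    by_contra hne
    obtain ⟨f, hf⟩ := hV (χ x) hne
    have hdvd : (f.comp χ).ker.index ∣ p := by
      rw [Subgroup.index_ker]
      simpa using (f.comp χ).range.card_subgroup_dvd_card
    refine hf (frattini_le_coatom (isCoatom_of_index_eq_prime hp
      (((Nat.dvd_prime hp).1 hdvd).resolve_left fun h1 => hf ?_)) hx : x ∈ (f.comp χ).ker)
    rw [Subgroup.index_eq_one] at h1
    have : x ∈ (f.comp χ).ker := h1 ▸ Subgroup.mem_top x
    exact this
  rw [h]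
  exact Nat.card_congr (QuotientGroup.quotientKerEquivOfSurjective χ hχ).toEquiv

end IsPGroup

theorem ConjClasses.ncard_carrier_mul_card_centralizer {G : Type*} [Group G] [Finite G] (g : G) :
    (ConjClasses.mk g).carrier.ncard * Nat.card (Subgroup.centralizer {g}) = Nat.card G := by
  have h : (Subgroup.centralizer {g}).index = (ConjClasses.mk g).carrier.ncard := by
    have h2 := Subgroup.index_comap_of_surjective (MulAction.stabilizer (ConjAct G) g)
      (f := (ConjAct.toConjAct (G := G)).toMonoidHom) ConjAct.toConjAct.surjective
    rw [MulAction.index_stabilizer, ConjAct.orbit_eq_carrier_conjClasses] at h2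
    rw [Subgroup.centralizer_eq_comap_stabilizer]
    exact h2
  rw [← h, mul_comm, Subgroup.card_mul_index]

theorem card_mul_SInvariant {G : Type*} [Group G] [Fintype G] (F : G → ℕ)
    (hF : ∀ g : G, Nat.log 3 (Nat.card (↥(Subgroup.centralizer {g}) ⧸
      frattini ↥(Subgroup.centralizer {g}))) = F g)
    (hconj : ∀ g h : G, IsConj g h → F g = F h) :
    Nat.card G * SInvariant G = ∑ g : G, F g * Nat.card (Subgroup.centralizer {g}) := by
  classical
  have := Fintype.ofFinite (ConjClasses G)
  rw [SInvariant, finsum_eq_sum_of_fintype, Finset.mul_sum,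
    ← Finset.sum_fiberwise (s := Finset.univ) (g := (ConjClasses.mk : G → ConjClasses G))
      (f := fun g => F g * Nat.card (Subgroup.centralizer {g}))]
  refine Finset.sum_congr rfl fun C _ => ?_
  rw [hF]
  have hrep := (ConjClasses.exists_rep C).choose_spec
  set r := (ConjClasses.exists_rep C).choose
  have hcard : 0 < C.carrier.ncard := by
    rw [Set.ncard_pos, ← hrep]
    exact ⟨r, ConjClasses.mem_carrier_mk⟩
  have key : ∀ g ∈ Finset.univ.filter (fun g : G => ConjClasses.mk g = C),
      F g * Nat.card (Subgroup.centralizer {g}) = F r * (Nat.card G / C.carrier.ncard) := by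
    intro g hg
    have hg : ConjClasses.mk g = C := by simpa using hg
    have h := ConjClasses.ncard_carrier_mul_card_centralizer g
    rw [hg] at h
    rw [hconj g r (ConjClasses.mk_eq_mk_iff_isConj.1 (hg.trans hrep.symm)), ← h,
      Nat.mul_div_cancel_left _ hcard]
  rw [Finset.sum_congr rfl key, Finset.sum_const, smul_eq_mul]
  have hfil : (Finset.univ.filter (fun g : G => ConjClasses.mk g = C)).card = C.carrier.ncard := by
    rw [← Set.ncard_coe_finset]
    congr 1
    ext g
    simp [ConjClasses.mem_carrier_iff_mk_eq]
  have hdvd : C.carrier.ncard ∣ Nat.card G := by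
    have h := ConjClasses.ncard_carrier_mul_card_centralizer r
    rw [hrep] at h
    exact ⟨_, h.symm⟩
  rw [hfil, mul_left_comm, Nat.mul_div_cancel' hdvd, mul_comm]

theorem surjective_of_apply_ne_one {P V : Type*} [Group P] [Group V] (hV : (Nat.card V).Prime)
    (f : P →* V) {x : P} (hx : f x ≠ 1) : Function.Surjective f := by
  have := Fact.mk hV
  rw [← MonoidHom.range_eq_top]
  refine (Subgroup.eq_bot_or_eq_top_of_prime_card f.range).resolve_left fun h => hx ?_
  have : f x ∈ f.range := ⟨x, rfl⟩
  rwa [h, Subgroup.mem_bot] at this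

/-- A group `G` which is an extension of a cyclic group of order three by an abelian `3`-group `A`,
with the structure constants of a `3`-group of maximal class. -/
structure MaxClassExtension (G A : Type*) [Group G] [AddCommGroup A] where
  /-- The embedding of the abelian normal subgroup. -/
  ι : Multiplicative A →* G
  ι_injective : Function.Injective ι
  /-- The projection to the cyclic quotient. -/
  deg : G →* Multiplicative (ZMod 3)
  deg_ker : deg.ker = ι.range
  /-- An element generating the cyclic quotient. -/
  a : G
  deg_a : deg a = Multiplicative.ofAdd 1
  /-- The action of `a` by conjugation. -/
  σ : A →+ A
  conj_a : ∀ x, a⁻¹ * ι (.ofAdd x) * a = ι (.ofAdd (σ x))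
  σ_norm : ∀ x, σ (σ x) + σ x + x = 0
  /-- The cube of `a`. -/
  z : A
  a_cube : a ^ 3 = ι (.ofAdd z)
  z_ne_zero : z ≠ 0
  /-- Two independent characters of `A`. -/
  π₁ : A →+ ZMod 3
  /-- The second character. -/
  π₂ : A →+ ZMod 3
  π_surjective : ∀ u v, ∃ x, π₁ x = u ∧ π₂ x = v
  π_ker : ∀ x, π₁ x = 0 → π₂ x = 0 → ∃ y, x = 3 • y
  π₁_σ : ∀ x, π₁ (σ x) = π₁ x
  π₁_ker : ∀ x, π₁ x = 0 → ∃ y, x = σ y - y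
  /-- The extension of `π₁` to `G`. -/
  χ : G →* Multiplicative (ZMod 3)
  χ_a : χ a = 1
  χ_ι : ∀ x, χ (ι (.ofAdd x)) = .ofAdd (π₁ x)

namespace MaxClassExtension

variable {G A : Type*} [Group G] [AddCommGroup A] (E : MaxClassExtension G A)

/-- The embedding of `A` as a function on `A`. -/
def emb (x : A) : G := E.ι (.ofAdd x)

theorem emb_add (x y : A) : E.emb (x + y) = E.emb x * E.emb y := by simp [emb]

theorem emb_zsmul (k : ℤ) (x : A) : E.emb (k • x) = E.emb x ^ k := by simp [emb]

theorem emb_neg (x : A) : E.emb (-x) = (E.emb x)⁻¹ := by simp [emb]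

theorem emb_injective : Function.Injective E.emb :=
  E.ι_injective.comp Multiplicative.ofAdd.injective

theorem mem_ker_iff {g : G} : g ∈ E.deg.ker ↔ ∃ x, E.emb x = g := by
  rw [E.deg_ker]
  exact ⟨fun ⟨x, hx⟩ => ⟨x.toAdd, hx⟩, fun ⟨x, hx⟩ => ⟨.ofAdd x, hx⟩⟩

theorem emb_mem_ker (x : A) : E.emb x ∈ E.deg.ker := E.mem_ker_iff.2 ⟨x, rfl⟩

theorem emb_mul_a (x : A) : E.emb x * E.a = E.a * E.emb (E.σ x) := by
  rw [emb, emb, ← E.conj_a]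
  group

theorem a_mul_emb_pow_three (y : A) : (E.a * E.emb y) ^ 3 = E.emb E.z := by
  have h : (E.a * E.emb y) ^ 3 = E.a * (E.emb y * E.a) * (E.emb y * E.a) * E.emb y := by
    simp only [pow_succ, pow_zero, one_mul, mul_assoc]
  rw [h, E.emb_mul_a]
  have h2 : E.a * (E.a * E.emb (E.σ y)) * (E.a * E.emb (E.σ y)) * E.emb y =
      E.a * E.a * (E.emb (E.σ y) * E.a) * E.emb (E.σ y) * E.emb y := by group
  rw [h2, E.emb_mul_a]
  have h3 : E.a * E.a * (E.a * E.emb (E.σ (E.σ y))) * E.emb (E.σ y) * E.emb y =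
      E.a ^ 3 * (E.emb (E.σ (E.σ y)) * E.emb (E.σ y) * E.emb y) := by
    simp only [pow_succ, pow_zero, one_mul, mul_assoc]
  rw [h3, ← emb_add, ← emb_add, E.σ_norm, E.a_cube, emb, emb, ofAdd_zero, map_one, mul_one]

theorem card_zmod : (Nat.card (Multiplicative (ZMod 3))).Prime := by
  simpa using Nat.prime_three

theorem deg_a_ne_one : E.deg E.a ≠ 1 := by
  rw [E.deg_a]
  decide

theorem index_ker : E.deg.ker.index = 3 := by
  rw [Subgroup.index_ker, MonoidHom.range_eq_top.2
    (surjective_of_apply_ne_one card_zmod E.deg E.deg_a_ne_one)]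
  simp

theorem card_ker : Nat.card E.deg.ker = Nat.card A := by
  rw [E.deg_ker]
  exact (Nat.card_congr (MonoidHom.ofInjective E.ι_injective).toEquiv).symm

theorem card_eq (E : MaxClassExtension G A) : Nat.card G = Nat.card A * 3 := by
  rw [← E.deg.ker.card_mul_index, E.index_ker, E.card_ker]

theorem ker_le_centralizer (x : A) : E.deg.ker ≤ Subgroup.centralizer {E.emb x} := by
  intro g hg
  obtain ⟨y, rfl⟩ := E.mem_ker_iff.1 hg
  rw [Subgroup.mem_centralizer_singleton_iff, ← emb_add, ← emb_add, add_comm]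

theorem centralizer_eq_top {x : A} {g : G} (hg : g * E.emb x = E.emb x * g)
    (hdeg : g ∉ E.deg.ker) : Subgroup.centralizer {E.emb x} = ⊤ := by
  refine (isCoatom_of_index_eq_prime Nat.prime_three E.index_ker).2 _
    (lt_of_le_of_ne (E.ker_le_centralizer x) fun h => hdeg ?_)
  rwa [h, Subgroup.mem_centralizer_singleton_iff]

theorem centralizer_eq_top_of_fixed {x : A} (hx : E.σ x = x) :
    Subgroup.centralizer {E.emb x} = ⊤ :=
  E.centralizer_eq_top (g := E.a) (by rw [emb_mul_a, hx]) E.deg_a_ne_one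

theorem fixed_of_centralizer_eq_top {x : A} (hx : Subgroup.centralizer {E.emb x} = ⊤) :
    E.σ x = x := by
  have h : E.a ∈ Subgroup.centralizer {E.emb x} := hx ▸ Subgroup.mem_top _
  rw [Subgroup.mem_centralizer_singleton_iff, emb_mul_a] at h
  exact (E.emb_injective (mul_left_cancel h)).symm

theorem centralizer_eq_ker {x : A} (hx : E.σ x ≠ x) :
    Subgroup.centralizer {E.emb x} = E.deg.ker := by
  refine le_antisymm (fun g hg => ?_) (E.ker_le_centralizer x)
  by_contra h
  exact hx (E.fixed_of_centralizer_eq_top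
    (E.centralizer_eq_top (Subgroup.mem_centralizer_singleton_iff.1 hg) h))

theorem σ_z : E.σ E.z = E.z := by
  apply E.emb_injective
  rw [emb, emb, ← E.conj_a, ← E.a_cube]
  group

theorem card_fixed [Finite A] : Nat.card (E.σ - AddMonoidHom.id A).ker = 3 := by
  have hrange : (E.σ - AddMonoidHom.id A).range = E.π₁.ker := by
    ext x
    constructor
    · rintro ⟨y, rfl⟩
      simp [AddMonoidHom.mem_ker, E.π₁_σ]
    · intro hx
      obtain ⟨y, rfl⟩ := E.π₁_ker x hx
      exact ⟨y, by simp⟩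
  have h1 := AddSubgroup.card_mul_index (E.σ - AddMonoidHom.id A).ker
  have h2 := AddSubgroup.card_mul_index E.π₁.ker
  rw [AddSubgroup.index_ker, hrange] at h1
  rw [AddSubgroup.index_ker, AddMonoidHom.range_eq_top.2 fun u =>
    (E.π_surjective u 0).imp fun _ h => h.1] at h2
  rw [AddSubgroup.card_top, Nat.card_zmod, ← h1, mul_comm] at h2
  exact (Nat.eq_of_mul_eq_mul_right Nat.card_pos h2).symm

theorem mem_zmultiples_z_iff [Finite A] {x : A} :
    x ∈ AddSubgroup.zmultiples E.z ↔ E.σ x = x := by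
  have := Fact.mk Nat.prime_three
  constructor
  · rintro ⟨k, rfl⟩
    simp [E.σ_z]
  · intro hx
    have hmem : ∀ y, E.σ y = y → y ∈ (E.σ - AddMonoidHom.id A).ker := fun y hy => by
      simp [AddMonoidHom.mem_ker, hy]
    obtain ⟨k, hk⟩ := mem_zmultiples_of_prime_card (p := 3) E.card_fixed
      (g := (⟨E.z, hmem _ E.σ_z⟩ : (E.σ - AddMonoidHom.id A).ker)) (g' := ⟨x, hmem _ hx⟩)
      (by simpa [Subtype.ext_iff] using E.z_ne_zero)
    exact ⟨k, by simpa using congrArg Subtype.val hk⟩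

theorem card_zmultiples_z [Finite A] : Nat.card (AddSubgroup.zmultiples E.z) = 3 := by
  rw [← E.card_fixed]
  congr 2
  ext x
  rw [E.mem_zmultiples_z_iff, AddMonoidHom.mem_ker]
  simp [sub_eq_zero]

theorem card_zpowers_emb_z [Finite A] : Nat.card (Subgroup.zpowers (E.emb E.z)) = 3 := by
  rw [Nat.card_zpowers, emb, orderOf_injective E.ι E.ι_injective, orderOf_ofAdd_eq_addOrderOf,
    ← Nat.card_zmultiples, E.card_zmultiples_z]

theorem emb_mem_zpowers_iff [Finite A] {x : A} :
    E.emb x ∈ Subgroup.zpowers (E.emb E.z) ↔ E.σ x = x := by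
  rw [← E.mem_zmultiples_z_iff, Subgroup.mem_zpowers_iff, AddSubgroup.mem_zmultiples_iff]
  simp_rw [← emb_zsmul, E.emb_injective.eq_iff]

theorem exists_pow_three_eq {g : G} (hg : g ∉ E.deg.ker) :
    ∃ h ∈ Subgroup.zpowers g, h ^ 3 = E.emb E.z := by
  have key : ∀ k : G, E.deg k = .ofAdd 1 → k ^ 3 = E.emb E.z := by
    intro k hk
    have : E.a⁻¹ * k ∈ E.deg.ker := by
      rw [MonoidHom.mem_ker, map_mul, map_inv, hk, E.deg_a, inv_mul_cancel]
    obtain ⟨y, hy⟩ := E.mem_ker_iff.1 this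
    rw [← E.a_mul_emb_pow_three y, hy, mul_inv_cancel_left]
  have hcases : ∀ u : Multiplicative (ZMod 3), u ≠ 1 → u = .ofAdd 1 ∨ u⁻¹ = .ofAdd 1 := by decide
  rcases hcases _ hg with h | h
  · exact ⟨g, Subgroup.mem_zpowers g, key g h⟩
  · exact ⟨g⁻¹, inv_mem (Subgroup.mem_zpowers g), key _ (by rw [map_inv, h])⟩

theorem mem_centralizer_inf_ker_iff [Finite A] {g : G} (hg : g ∉ E.deg.ker) {h : G} :
    h ∈ Subgroup.centralizer {g} ∧ h ∈ E.deg.ker ↔ h ∈ Subgroup.zpowers (E.emb E.z) := by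
  constructor
  · rintro ⟨h1, h2⟩
    obtain ⟨x, rfl⟩ := E.mem_ker_iff.1 h2
    rw [E.emb_mem_zpowers_iff]
    exact E.fixed_of_centralizer_eq_top (E.centralizer_eq_top
      (Subgroup.mem_centralizer_singleton_iff.1 h1).symm hg)
  · intro hz
    obtain ⟨k, rfl⟩ := Subgroup.mem_zpowers_iff.1 hz
    refine ⟨?_, ?_⟩
    · rw [← emb_zsmul, Subgroup.mem_centralizer_singleton_iff]
      have h : g ∈ Subgroup.centralizer {E.emb (k • E.z)} := by
        rw [E.centralizer_eq_top_of_fixed (by rw [map_zsmul, E.σ_z])]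
        exact Subgroup.mem_top g
      exact (Subgroup.mem_centralizer_singleton_iff.1 h).symm
    · rw [← emb_zsmul]
      exact E.emb_mem_ker _

theorem card_centralizer_of_notMem [Finite A] {g : G} (hg : g ∉ E.deg.ker) :
    Nat.card (Subgroup.centralizer {g}) = 9 := by
  have h := (E.deg.comp (Subgroup.centralizer {g}).subtype).ker.card_mul_index
  have hgg : g ∈ Subgroup.centralizer {g} := Subgroup.mem_centralizer_singleton_iff.2 rfl
  rw [Subgroup.index_ker, MonoidHom.range_eq_top.2 (surjective_of_apply_ne_one card_zmod
    (E.deg.comp (Subgroup.centralizer {g}).subtype) (x := ⟨g, hgg⟩) hg)] at h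
  have hker : ((E.deg.comp (Subgroup.centralizer {g}).subtype).ker).map
      (Subgroup.centralizer {g}).subtype = Subgroup.zpowers (E.emb E.z) := by
    ext k
    rw [← E.mem_centralizer_inf_ker_iff hg]
    constructor
    · rintro ⟨k, hk, rfl⟩
      exact ⟨k.2, hk⟩
    · rintro ⟨h1, h2⟩
      exact ⟨⟨k, h1⟩, h2, rfl⟩
  rw [← Subgroup.card_map_of_injective (Subgroup.subtype_injective _), hker,
    E.card_zpowers_emb_z, Subgroup.card_top] at h
  simpa using h.symm

theorem exists_hom_ne_one_prod (v : Multiplicative (ZMod 3) × Multiplicative (ZMod 3))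
    (hv : v ≠ 1) :
    ∃ f : Multiplicative (ZMod 3) × Multiplicative (ZMod 3) →* Multiplicative (ZMod 3),
      f v ≠ 1 := by
  by_cases h : v.1 = 1
  · exact ⟨MonoidHom.snd _ _, fun h2 => hv (Prod.ext h h2)⟩
  · exact ⟨MonoidHom.fst _ _, h⟩

theorem isPGroup (E : MaxClassExtension G A) {m : ℕ}
    (hA : Nat.card A = 3 ^ (m + 1)) : IsPGroup 3 G :=
  IsPGroup.of_card (n := m + 2) (by rw [E.card_eq, hA, ← pow_succ])

theorem finite (E : MaxClassExtension G A) [Finite A] : Finite G :=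
  Nat.finite_of_card_ne_zero (by rw [E.card_eq]; exact mul_ne_zero Nat.card_pos.ne' (by norm_num))

theorem card_frattini_quotient_of_fixed [Finite G] (hG : IsPGroup 3 G) {x : A}
    (hx : E.σ x = x) :
    Nat.card (↥(Subgroup.centralizer {E.emb x}) ⧸
      frattini ↥(Subgroup.centralizer {E.emb x})) = 9 := by
  have := Fact.mk Nat.prime_three
  have htop := E.centralizer_eq_top_of_fixed hx
  have hmem : ∀ g, g ∈ Subgroup.centralizer {E.emb x} := fun g => htop ▸ Subgroup.mem_top g
  rw [IsPGroup.card_quotient_frattini (p := 3)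
    ((E.deg.prod E.χ).comp (Subgroup.centralizer {E.emb x}).subtype) ?_ exists_hom_ne_one_prod ?_]
  · simp
  · rintro ⟨u, v⟩
    obtain ⟨y, hy, -⟩ := E.π_surjective v.toAdd 0
    refine ⟨⟨E.a ^ u.toAdd.val * E.emb y, hmem _⟩, Prod.ext ?_ ?_⟩
    · have : E.deg (E.emb y) = 1 := E.emb_mem_ker y
      simp [this, E.deg_a, ← ofAdd_nsmul]
    · have : E.χ (E.emb y) = v := (E.χ_ι y).trans (congrArg Multiplicative.ofAdd hy)
      simp [E.χ_a, this]
  · rintro M hM ⟨g, hg⟩ hk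
    have hk1 : E.deg g = 1 := congrArg Prod.fst hk
    have hk2 : E.χ g = 1 := congrArg Prod.snd hk
    obtain ⟨w, rfl⟩ := E.mem_ker_iff.1 hk1
    rw [emb, E.χ_ι] at hk2
    obtain ⟨y, rfl⟩ := E.π₁_ker w hk2
    convert (hG.to_subgroup _).mul_mul_inv_mul_inv_mem_of_isCoatom hM ⟨E.a⁻¹, hmem _⟩
      ⟨E.emb y, hmem _⟩ using 1
    ext
    change E.emb (E.σ y - y) = E.a⁻¹ * E.emb y * E.a⁻¹⁻¹ * (E.emb y)⁻¹
    rw [inv_inv, sub_eq_add_neg, emb_add, emb_neg]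
    exact congrArg (· * (E.emb y)⁻¹) (E.conj_a y).symm

theorem card_frattini_quotient_of_not_fixed [Finite G] (hG : IsPGroup 3 G) {x : A}
    (hx : E.σ x ≠ x) :
    Nat.card (↥(Subgroup.centralizer {E.emb x}) ⧸
      frattini ↥(Subgroup.centralizer {E.emb x})) = 9 := by
  have := Fact.mk Nat.prime_three
  have hC := E.centralizer_eq_ker hx
  have hmem : ∀ y, E.emb y ∈ Subgroup.centralizer {E.emb x} := fun y => hC ▸ E.emb_mem_ker y
  let e := MonoidHom.ofInjective E.ι_injective
  let f : Subgroup.centralizer {E.emb x} →* E.ι.range :=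
    Subgroup.inclusion (hC.trans E.deg_ker).le
  have hf : ∀ y, e.symm (f ⟨E.emb y, hmem y⟩) = .ofAdd y := fun y => by
    rw [MulEquiv.symm_apply_eq]
    rfl
  rw [IsPGroup.card_quotient_frattini (p := 3)
    (((E.π₁.toMultiplicative).prod (E.π₂.toMultiplicative)).comp (e.symm.toMonoidHom.comp f))
    ?_ exists_hom_ne_one_prod ?_]
  · simp
  · rintro ⟨u, v⟩
    obtain ⟨y, hu, hv⟩ := E.π_surjective u.toAdd v.toAdd
    refine ⟨⟨E.emb y, hmem y⟩, Prod.ext ?_ ?_⟩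
    · simp [hf, hu]
    · simp [hf, hv]
  · rintro M hM ⟨g, hg⟩ hk
    obtain ⟨w, rfl⟩ := E.mem_ker_iff.1 (hC ▸ hg)
    have hk1 : E.π₁ w = 0 := by simpa [hf] using congrArg Prod.fst hk
    have hk2 : E.π₂ w = 0 := by simpa [hf] using congrArg Prod.snd hk
    obtain ⟨y, rfl⟩ := E.π_ker w hk1 hk2
    convert (hG.to_subgroup _).pow_mem_of_isCoatom hM ⟨E.emb y, hmem _⟩ using 1
    ext
    change E.emb (3 • y) = E.emb y ^ 3
    simp [emb]

theorem card_frattini_quotient_of_notMem [Finite A] [Finite G] (hG : IsPGroup 3 G) {g : G}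
    (hg : g ∉ E.deg.ker) :
    Nat.card (↥(Subgroup.centralizer {g}) ⧸ frattini ↥(Subgroup.centralizer {g})) = 3 := by
  have := Fact.mk Nat.prime_three
  have hgg : g ∈ Subgroup.centralizer {g} := Subgroup.mem_centralizer_singleton_iff.2 rfl
  rw [IsPGroup.card_quotient_frattini (p := 3)
    (E.deg.comp (Subgroup.centralizer {g}).subtype)
    (surjective_of_apply_ne_one card_zmod _ (x := ⟨g, hgg⟩) hg)
    (fun v hv => ⟨MonoidHom.id _, hv⟩) ?_]
  · simp
  · rintro M hM ⟨h, hh⟩ hk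
    obtain ⟨k, rfl⟩ := Subgroup.mem_zpowers_iff.1 ((E.mem_centralizer_inf_ker_iff hg).1 ⟨hh, hk⟩)
    obtain ⟨l, hl, hl3⟩ := E.exists_pow_three_eq hg
    have hlC : l ∈ Subgroup.centralizer {g} := (Subgroup.zpowers_le.2 hgg) hl
    convert M.zpow_mem ((hG.to_subgroup _).pow_mem_of_isCoatom hM ⟨l, hlC⟩) k using 1
    ext
    simp [hl3]

theorem SInvariant_eq (E : MaxClassExtension G A) {m : ℕ}
    (hA : Nat.card A = 3 ^ (m + 1)) :
    SInvariant G = 10 + 2 * 3 ^ m := by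
  classical
  have : Finite A := Nat.finite_of_card_ne_zero (by rw [hA]; positivity)
  have := E.finite
  have := Fintype.ofFinite G
  have hG := E.isPGroup hA
  have hlog : ∀ g : G, Nat.log 3 (Nat.card (↥(Subgroup.centralizer {g}) ⧸
      frattini ↥(Subgroup.centralizer {g}))) = if g ∈ E.deg.ker then 2 else 1 := by
    intro g
    split_ifs with hg
    · obtain ⟨x, rfl⟩ := E.mem_ker_iff.1 hg
      by_cases hx : E.σ x = x
      · rw [E.card_frattini_quotient_of_fixed hG hx]
        exact Nat.log_pow (b := 3) (by norm_num) 2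
      · rw [E.card_frattini_quotient_of_not_fixed hG hx]
        exact Nat.log_pow (b := 3) (by norm_num) 2
    · rw [E.card_frattini_quotient_of_notMem hG hg]
      exact Nat.log_pow (b := 3) (by norm_num) 1
  have hsum := card_mul_SInvariant _ hlog fun g h hgh => by
    obtain ⟨c, rfl⟩ := isConj_iff.1 hgh
    simp only [MonoidHom.mem_ker, map_mul, map_inv, mul_inv_cancel_comm]
  have hterm : ∀ g : G, (((if g ∈ E.deg.ker then 2 else 1) *
      Nat.card (Subgroup.centralizer {g}) : ℕ) : ℤ) = 9 +
      (if g ∈ E.deg.ker then 6 * 3 ^ m - 9 else 0) +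
      (if g ∈ Subgroup.zpowers (E.emb E.z) then 12 * 3 ^ m else 0) := by
    intro g
    by_cases hg : g ∈ E.deg.ker
    · obtain ⟨x, rfl⟩ := E.mem_ker_iff.1 hg
      simp only [hg, if_true, E.emb_mem_zpowers_iff]
      by_cases hx : E.σ x = x
      · rw [E.centralizer_eq_top_of_fixed hx, Subgroup.card_top, E.card_eq, hA, if_pos hx]
        push_cast
        ring
      · rw [E.centralizer_eq_ker hx, E.card_ker, hA, if_neg hx]
        push_cast
        ring
    · have hz : g ∉ Subgroup.zpowers (E.emb E.z) := fun h =>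
        hg ((E.mem_centralizer_inf_ker_iff hg).2 h).2
      rw [E.card_centralizer_of_notMem hg]
      simp [hg, hz]
  have hcount : ∀ (H : Subgroup G) [DecidablePred (· ∈ H)],
      ((Finset.univ.filter fun g => g ∈ H).card : ℤ) = Nat.card H :=
    fun H _ => by rw [Nat.card_eq_fintype_card, Fintype.card_subtype]
  have hsum' := congrArg (Nat.cast : ℕ → ℤ) hsum
  rw [Nat.cast_sum, Finset.sum_congr rfl fun g _ => hterm g, Finset.sum_add_distrib,
    Finset.sum_add_distrib, ← Finset.sum_filter, ← Finset.sum_filter] at hsum'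
  simp only [Finset.sum_const, nsmul_eq_mul, hcount, Finset.card_univ] at hsum'
  rw [E.card_ker, E.card_zpowers_emb_z, ← Nat.card_eq_fintype_card, E.card_eq, hA] at hsum'
  push_cast at hsum'
  have hpos : (0 : ℤ) < 9 * 3 ^ m := by positivity
  have : (SInvariant G : ℤ) = 10 + 2 * 3 ^ m := by
    refine mul_left_cancel₀ hpos.ne' ?_
    linear_combination hsum'
  exact_mod_cast this

end MaxClassExtension

/-- The homomorphism from `ℤ/N × ℤ/M` determined by the images of the two generators. -/
def ZMod.prodLift {B : Type*} [AddGroup B] (N M : ℕ) (b c : B) (hb : N • b = 0) (hc : M • c = 0)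
    (hbc : AddCommute b c) : ZMod N × ZMod M →+ B :=
  AddMonoidHom.noncommCoprod
    (ZMod.lift N ⟨zmultiplesHom B b, by simpa using hb⟩)
    (ZMod.lift M ⟨zmultiplesHom B c, by simpa using hc⟩) (fun x y => by
      obtain ⟨i, rfl⟩ := ZMod.intCast_surjective x
      obtain ⟨j, rfl⟩ := ZMod.intCast_surjective y
      simpa using (hbc.zsmul_left i).zsmul_right j)

@[simp]
theorem ZMod.prodLift_intCast {B : Type*} [AddGroup B] (N M : ℕ) (b c : B) (hb : N • b = 0)
    (hc : M • c = 0) (hbc : AddCommute b c) (i j : ℤ) :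
    ZMod.prodLift N M b c hb hc hbc ((i : ZMod N), (j : ZMod M)) = i • b + j • c := by
  simp [ZMod.prodLift]

namespace MaxClass3

/-- The relations of `T4 n` for elements of an arbitrary group. -/
structure T4Relations {H : Type*} [Group H] (n : ℕ) (a b c d : H) : Prop where
  comm_b_a : c = gpComm b a
  comm_c_a : d = gpComm c a
  comm_d_a : gpComm d a * d ^ 3 * c ^ 3 = 1
  comm_d_b : gpComm d b = 1
  comm_d_c : gpComm d c = 1
  c_pow : c ^ 3 ^ ((n - 1) / 2) = 1
  d_pow : d ^ 3 ^ (n / 2 - 1) = 1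
  a_cube : a ^ 3 = if Even n then d ^ ((-3 : ℤ) ^ ((n - 4) / 2)) else c ^ ((-3 : ℤ) ^ ((n - 3) / 2))
  b_cube : b ^ 3 * d * c ^ 3 = 1
  comm_c_b : gpComm c b = 1

theorem map_gpComm {G H : Type*} [Group G] [Group H] (f : G →* H) (x y : G) :
    f (gpComm x y) = gpComm (f x) (f y) := by simp [gpComm]

theorem T4.relations (n : ℕ) (hn : 4 ≤ n) :
    T4Relations n (PresentedGroup.of 0 : T4 n) (PresentedGroup.of 1) (PresentedGroup.of 2)
      (PresentedGroup.of 3) := by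
  have key : ∀ w ∈ T4rels n, PresentedGroup.mk (T4rels n) w = 1 :=
    fun w hw => PresentedGroup.one_of_mem hw
  have hK : ∀ w ∈ ({c⁻¹ * gpComm b a, d⁻¹ * gpComm c a, gpComm d a * d ^ 3 * c ^ 3, gpComm d b,
      gpComm d c} : Set (FreeGroup (Fin 4))), PresentedGroup.mk (T4rels n) w = 1 :=
    fun w hw => key w (Or.inl (Or.inl hw))
  have hE : ∀ w ∈ (if Even n then {c ^ 3 ^ ((n - 2) / 2), d ^ 3 ^ ((n - 2) / 2)}
      else {c ^ 3 ^ ((n - 1) / 2), d ^ 3 ^ ((n - 3) / 2)} : Set (FreeGroup (Fin 4))),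
      PresentedGroup.mk (T4rels n) w = 1 :=
    fun w hw => key w (Or.inl (Or.inr hw))
  have hT : ∀ w ∈ ({a ^ 3 * (zWord n)⁻¹, b ^ 3 * d * c ^ 3, gpComm c b} :
      Set (FreeGroup (Fin 4))), PresentedGroup.mk (T4rels n) w = 1 :=
    fun w hw => key w (Or.inr hw)
  simp only [Set.mem_insert_iff, Set.mem_singleton_iff, forall_eq_or_imp, forall_eq, map_mul,
    map_inv, map_pow, map_gpComm, inv_mul_eq_one, mul_inv_eq_one] at hK hT
  obtain ⟨h1, h2, h3, h4, h5⟩ := hK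
  obtain ⟨h6, h7, h8⟩ := hT
  have hcd : PresentedGroup.mk (T4rels n) c ^ 3 ^ ((n - 1) / 2) = 1 ∧
      PresentedGroup.mk (T4rels n) d ^ 3 ^ (n / 2 - 1) = 1 := by
    rcases Nat.even_or_odd' n with ⟨k, rfl | rfl⟩
    · simp only [even_two, Even.mul_right, if_true, Set.mem_insert_iff, Set.mem_singleton_iff,
        forall_eq_or_imp, forall_eq, map_pow] at hE
      rwa [show (2 * k - 1) / 2 = (2 * k - 2) / 2 by omega,
        show 2 * k / 2 - 1 = (2 * k - 2) / 2 by omega]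
    · simp only [Nat.not_even_bit1, if_false, Set.mem_insert_iff, Set.mem_singleton_iff,
        forall_eq_or_imp, forall_eq, map_pow] at hE
      rwa [show (2 * k + 1) / 2 - 1 = (2 * k + 1 - 3) / 2 by omega]
  refine ⟨h1, h2, h3, h4, h5, hcd.1, hcd.2, h6.trans ?_, h7, h8⟩
  rw [zWord]
  split_ifs <;> exact map_zpow _ _ _

theorem T4.exists_hom {H : Type*} [Group H] {n : ℕ} (hn : 4 ≤ n) {x y z w : H}
    (h : T4Relations n x y z w) : ∃ f : T4 n →* H, f (PresentedGroup.of 0) = x ∧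
      f (PresentedGroup.of 1) = y ∧ f (PresentedGroup.of 2) = z ∧ f (PresentedGroup.of 3) = w := by
  have hrel : ∀ r ∈ T4rels n, FreeGroup.lift ![x, y, z, w] r = 1 := by
    have ha : FreeGroup.lift ![x, y, z, w] a = x := by simp
    have hb : FreeGroup.lift ![x, y, z, w] b = y := by simp
    have hc : FreeGroup.lift ![x, y, z, w] c = z := by simp
    have hd : FreeGroup.lift ![x, y, z, w] d = w := by simp
    rintro r ((hr | hr) | hr)
    · rcases hr with rfl | rfl | rfl | rfl | rfl
      · rw [map_mul, map_inv, map_gpComm, hb, hc, ha, ← h.comm_b_a, inv_mul_cancel]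
      · rw [map_mul, map_inv, map_gpComm, hd, hc, ha, ← h.comm_c_a, inv_mul_cancel]
      · rw [map_mul, map_mul, map_pow, map_pow, map_gpComm, hd, hc, ha, h.comm_d_a]
      · rw [map_gpComm, hd, hb, h.comm_d_b]
      · rw [map_gpComm, hd, hc, h.comm_d_c]
    · have h1 := h.c_pow
      have h2 := h.d_pow
      rcases Nat.even_or_odd' n with ⟨k, rfl | rfl⟩
      · simp only [even_two, Even.mul_right, if_true] at hr
        rw [show (2 * k - 1) / 2 = (2 * k - 2) / 2 by omega] at h1
        rw [show 2 * k / 2 - 1 = (2 * k - 2) / 2 by omega] at h2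
        rcases hr with rfl | rfl
        · rw [map_pow, hc, h1]
        · rw [map_pow, hd, h2]
      · simp only [Nat.not_even_bit1, if_false] at hr
        rw [show (2 * k + 1) / 2 - 1 = (2 * k + 1 - 3) / 2 by omega] at h2
        rcases hr with rfl | rfl
        · rw [map_pow, hc, h1]
        · rw [map_pow, hd, h2]
    · rcases hr with rfl | rfl | rfl
      · rw [map_mul, map_inv, map_pow, ha, h.a_cube, zWord, mul_inv_eq_one]
        split_ifs
        · rw [map_zpow, hd]
        · rw [map_zpow, hc]
      · rw [map_mul, map_mul, map_pow, map_pow, hb, hd, hc, h.b_cube]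
      · rw [map_gpComm, hc, hb, h.comm_c_b]
  exact ⟨PresentedGroup.toGroup hrel, by simp, by simp, by simp, by simp⟩

theorem gpComm_eq_one_iff {G : Type*} [Group G] {x y : G} : gpComm x y = 1 ↔ Commute x y := by
  rw [gpComm, mul_assoc, ← mul_inv_rev, inv_mul_eq_one, eq_comm]
  rfl

/-- The abelian maximal subgroup of `T4 n`, as an additive group. -/
abbrev Base (n : ℕ) : Type := ZMod (3 ^ (n / 2)) × ZMod (3 ^ ((n - 1) / 2))

namespace Base

/-- The element with given integral coordinates. -/
def el (n : ℕ) (i j : ℤ) : Base n := ((i : ZMod _), (j : ZMod _))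

variable {n : ℕ}

theorem exists_el (x : Base n) : ∃ i j : ℤ, x = el n i j := by
  obtain ⟨i, hi⟩ := ZMod.intCast_surjective x.1
  obtain ⟨j, hj⟩ := ZMod.intCast_surjective x.2
  exact ⟨i, j, Prod.ext hi.symm hj.symm⟩

theorem el_add (i j k l : ℤ) : el n i j + el n k l = el n (i + k) (j + l) := by
  simp [el]

theorem zsmul_el (k i j : ℤ) : k • el n i j = el n (k * i) (k * j) := by
  simp [el]

theorem el_eq (i j : ℤ) : el n i j = i • el n 1 0 + j • el n 0 1 := by
  rw [zsmul_el, zsmul_el, el_add]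
  simp

theorem el_eq_zero_iff {i j : ℤ} :
    el n i j = 0 ↔ (3 : ℤ) ^ (n / 2) ∣ i ∧ (3 : ℤ) ^ ((n - 1) / 2) ∣ j := by
  simp [el, Prod.ext_iff, ZMod.intCast_zmod_eq_zero_iff_dvd]

theorem monoidHom_ext {H : Type*} [Group H] {f g : Multiplicative (Base n) →* H}
    (h1 : f (.ofAdd (el n 1 0)) = g (.ofAdd (el n 1 0)))
    (h2 : f (.ofAdd (el n 0 1)) = g (.ofAdd (el n 0 1))) : f = g := by
  refine MonoidHom.ext fun x => ?_
  obtain ⟨i, j, hx⟩ := exists_el x.toAdd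
  rw [← ofAdd_toAdd x, hx, el_eq]
  simp only [ofAdd_add, ofAdd_zsmul, map_mul, map_zpow, h1, h2]

/-- The action of `a` on the base. -/
def act (n : ℕ) : Base n →+ Base n :=
  ZMod.prodLift _ _ (el n 1 1) (el n (-3) (-2))
    (by
      rw [← natCast_zsmul, zsmul_el, el_eq_zero_iff]
      push_cast
      exact ⟨Dvd.intro _ rfl, Dvd.dvd.mul_right (pow_dvd_pow _ (by omega)) _⟩)
    (by
      rw [← natCast_zsmul, zsmul_el, el_eq_zero_iff]
      push_cast
      refine ⟨?_, Dvd.intro _ rfl⟩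
      rw [mul_neg, dvd_neg, ← pow_succ]
      exact pow_dvd_pow _ (by omega))
    (AddCommute.all _ _)

theorem act_el (i j : ℤ) : act n (el n i j) = el n (i - 3 * j) (i - 2 * j) := by
  rw [act]
  refine (ZMod.prodLift_intCast _ _ _ _ _ _ _ i j).trans ?_
  rw [zsmul_el, zsmul_el, el_add]
  ring_nf

theorem act_norm (x : Base n) : act n (act n x) + act n x + x = 0 := by
  obtain ⟨i, j, rfl⟩ := exists_el x
  rw [act_el, act_el, el_add, el_add, el_eq_zero_iff]
  ring_nf
  simp

/-- The generator of the subgroup of fixed points of the action. -/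
def socle (n : ℕ) : Base n :=
  if Even n then (-3 : ℤ) ^ ((n - 4) / 2) • el n (-3) (-3)
  else (-3 : ℤ) ^ ((n - 3) / 2) • el n 0 1

/-- An element of order three mapped to `socle n` by `act n - 1`. -/
def presocle (n : ℕ) : Base n :=
  if Even n then (-3 : ℤ) ^ ((n - 4) / 2) • el n 0 1
  else (-3 : ℤ) ^ ((n - 3) / 2) • el n 1 0

theorem act_presocle : act n (presocle n) - presocle n = socle n := by
  rw [presocle, socle]
  split_ifs <;>
  · rw [map_zsmul, ← smul_sub, act_el, sub_eq_iff_eq_add.2]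
    rw [el_add]
    norm_num

theorem pow_dvd_neg_pow_iff {k l : ℕ} : (3 : ℤ) ^ k ∣ (-3) ^ l ↔ k ≤ l := by
  rw [← Int.natAbs_dvd_natAbs, Int.natAbs_pow, Int.natAbs_pow]
  exact Nat.pow_dvd_pow_iff_le_right (by norm_num)

theorem three_nsmul_presocle (hn : 4 ≤ n) : 3 • presocle n = 0 := by
  have h : ∀ k : ℕ, (3 : ℤ) * (-3) ^ k * 1 = -(-3) ^ (k + 1) := fun k => by ring
  rw [presocle, ← natCast_zsmul]
  split_ifs with he
  · obtain ⟨k, rfl⟩ := he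
    rw [smul_smul, zsmul_el, el_eq_zero_iff]
    push_cast
    rw [h, mul_zero, dvd_neg, pow_dvd_neg_pow_iff]
    exact ⟨dvd_zero _, by omega⟩
  · rw [Nat.not_even_iff_odd] at he
    obtain ⟨k, rfl⟩ := he
    rw [smul_smul, zsmul_el, el_eq_zero_iff]
    push_cast
    rw [h, mul_zero, dvd_neg, pow_dvd_neg_pow_iff]
    exact ⟨by omega, dvd_zero _⟩

theorem socle_ne_zero (hn : 4 ≤ n) : socle n ≠ 0 := by
  rw [socle]
  split_ifs with he
  · rw [zsmul_el, Ne, el_eq_zero_iff, ← pow_succ, pow_dvd_neg_pow_iff]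
    obtain ⟨k, rfl⟩ := he
    omega
  · rw [zsmul_el, Ne, el_eq_zero_iff, mul_one, pow_dvd_neg_pow_iff (l := (n - 3) / 2)]
    omega

/-- Reduction of the first coordinate modulo three. -/
def fstMod (hn : 4 ≤ n) : Base n →+ ZMod 3 :=
  ((ZMod.castHom (dvd_pow_self 3 (by omega)) (ZMod 3) : ZMod (3 ^ (n / 2)) →+* ZMod 3) :
    ZMod (3 ^ (n / 2)) →+ ZMod 3).comp (AddMonoidHom.fst _ _)

/-- Reduction of the second coordinate modulo three. -/
def sndMod (hn : 4 ≤ n) : Base n →+ ZMod 3 :=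
  ((ZMod.castHom (dvd_pow_self 3 (by omega)) (ZMod 3) : ZMod (3 ^ ((n - 1) / 2)) →+* ZMod 3) :
    ZMod (3 ^ ((n - 1) / 2)) →+ ZMod 3).comp (AddMonoidHom.snd _ _)

theorem fstMod_el (hn : 4 ≤ n) (i j : ℤ) : fstMod hn (el n i j) = i :=
  map_intCast (ZMod.castHom (dvd_pow_self 3 (by omega)) (ZMod 3)) i

theorem sndMod_el (hn : 4 ≤ n) (i j : ℤ) : sndMod hn (el n i j) = j :=
  map_intCast (ZMod.castHom (dvd_pow_self 3 (by omega)) (ZMod 3)) j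

theorem fstMod_act (hn : 4 ≤ n) (x : Base n) : fstMod hn (act n x) = fstMod hn x := by
  obtain ⟨i, j, rfl⟩ := exists_el x
  have h3 : (3 : ZMod 3) = 0 := rfl
  rw [act_el, fstMod_el, fstMod_el]
  push_cast
  rw [h3, zero_mul, sub_zero]

theorem exists_act_sub_eq (hn : 4 ≤ n) (x : Base n) (hx : fstMod hn x = 0) :
    ∃ y, x = act n y - y := by
  obtain ⟨i, j, rfl⟩ := exists_el x
  rw [fstMod_el, ZMod.intCast_zmod_eq_zero_iff_dvd] at hx
  obtain ⟨k, rfl⟩ := hx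
  refine ⟨el n (j - 3 * k) (-k), ?_⟩
  rw [act_el, eq_sub_iff_add_eq, el_add]
  push_cast
  ring_nf

theorem exists_three_nsmul_eq (hn : 4 ≤ n) (x : Base n) (hx : fstMod hn x = 0)
    (hy : sndMod hn x = 0) : ∃ y, x = 3 • y := by
  obtain ⟨i, j, rfl⟩ := exists_el x
  rw [fstMod_el, ZMod.intCast_zmod_eq_zero_iff_dvd] at hx
  rw [sndMod_el, ZMod.intCast_zmod_eq_zero_iff_dvd] at hy
  obtain ⟨k, rfl⟩ := hx
  obtain ⟨l, rfl⟩ := hy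
  exact ⟨el n k l, by rw [← natCast_zsmul, zsmul_el]⟩

theorem exists_mod_eq (hn : 4 ≤ n) (u v : ZMod 3) :
    ∃ x : Base n, fstMod hn x = u ∧ sndMod hn x = v := by
  obtain ⟨i, rfl⟩ := ZMod.intCast_surjective u
  obtain ⟨j, rfl⟩ := ZMod.intCast_surjective v
  exact ⟨el n i j, fstMod_el hn i j, sndMod_el hn i j⟩

end Base

open Base Multiplicative

/-- Elements of a group satisfy the relations of `T4 n` as soon as they come from a homomorphism
from the base on which `a` acts by `act n` and has cube `socle n`. -/
theorem T4Relations.of_base {H : Type*} [Group H] {n : ℕ} (hn : 4 ≤ n)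
    (T : Multiplicative (Base n) →* H) (α : H)
    (hconj : ∀ x, α⁻¹ * T (ofAdd x) * α = T (ofAdd (act n x)))
    (hcube : α ^ 3 = T (ofAdd (socle n))) :
    T4Relations n α (T (ofAdd (el n 1 0))) (T (ofAdd (el n 0 1)))
      (T (ofAdd (el n (-3) (-3)))) := by
  have hcomm : ∀ x, gpComm (T (ofAdd x)) α = T (ofAdd (-x + act n x)) := fun x => by
    rw [ofAdd_add, map_mul, ← hconj, ofAdd_neg, map_inv, gpComm]
    simp only [mul_assoc]
  have hbase : ∀ x y, gpComm (T (ofAdd x)) (T (ofAdd y)) = 1 := fun x y => by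
    rw [gpComm_eq_one_iff]
    exact (Commute.all (ofAdd x) (ofAdd y)).map T
  have hneg : ∀ i j, -el n i j = el n (-i) (-j) := fun i j => by
    simpa using zsmul_el (n := n) (-1) i j
  refine ⟨?_, ?_, ?_, hbase _ _, hbase _ _, ?_, ?_, ?_, ?_, hbase _ _⟩
  · rw [hcomm, act_el, hneg, el_add]
    norm_num
  · rw [hcomm, act_el, hneg, el_add]
    norm_num
  · rw [hcomm, act_el, hneg, el_add]
    simp only [← map_pow, ← ofAdd_nsmul, ← map_mul, ← ofAdd_add, ← natCast_zsmul, zsmul_el, el_add]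
    norm_num
    simp only [el, Int.cast_zero]
    exact map_one T
  · rw [← map_pow, ← ofAdd_nsmul, ← natCast_zsmul, zsmul_el, el_eq_zero_iff.2, ofAdd_zero, map_one]
    push_cast
    simp
  · rw [← map_pow, ← ofAdd_nsmul, ← natCast_zsmul, zsmul_el, el_eq_zero_iff.2, ofAdd_zero, map_one]
    push_cast
    simp only [mul_neg, dvd_neg, ← pow_succ]
    exact ⟨pow_dvd_pow _ (by omega), pow_dvd_pow _ (by omega)⟩
  · rw [hcube, socle]
    split_ifs
    · rw [ofAdd_zsmul, map_zpow]
    · rw [ofAdd_zsmul, map_zpow]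
  · simp only [← map_pow, ← ofAdd_nsmul, ← map_mul, ← ofAdd_add, ← natCast_zsmul, zsmul_el, el_add]
    norm_num
    simp only [el, Int.cast_zero]
    exact map_one T

/-- The base acting on `Base n × ZMod 3` by translations. -/
def translation (n : ℕ) : Multiplicative (Base n) →* Equiv.Perm (Base n × ZMod 3) where
  toFun x := Equiv.prodCongr (Equiv.addLeft x.toAdd) (Equiv.refl _)
  map_one' := by ext x <;> simp
  map_mul' x y := by ext x <;> simp [add_assoc]

theorem translation_apply (n : ℕ) (x y : Base n) (s : ZMod 3) :
    translation n (ofAdd x) (y, s) = (x + y, s) := rfl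

theorem translation_injective (n : ℕ) : Function.Injective (translation n) := by
  intro x y h
  have h2 := congrArg Prod.fst (congrFun (congrArg DFunLike.coe h) (0, 0))
  have h3 : x.toAdd + 0 = y.toAdd + 0 := h2
  simpa using h3

/-- The homomorphism from `ZMod 3` sending `1` to `presocle n`. -/
def presocleHom {n : ℕ} (hn : 4 ≤ n) : ZMod 3 →+ Base n :=
  ZMod.lift 3 ⟨zmultiplesHom _ (presocle n), by
    simpa [← natCast_zsmul] using three_nsmul_presocle hn⟩

theorem presocleHom_one {n : ℕ} (hn : 4 ≤ n) : presocleHom hn 1 = presocle n := by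
  have := ZMod.lift_coe 3 ⟨zmultiplesHom (Base n) (presocle n), by
    simpa [← natCast_zsmul] using three_nsmul_presocle hn⟩ 1
  simpa [presocleHom] using this

/-- An affine map normalising the translations. -/
def affineMap {n : ℕ} (hn : 4 ≤ n) (v : Base n × ZMod 3) : Base n × ZMod 3 :=
  (act n v.1 - presocleHom hn v.2, v.2 + 1)

theorem affineMap_iterate {n : ℕ} (hn : 4 ≤ n) (v : Base n × ZMod 3) :
    affineMap hn (affineMap hn (affineMap hn v)) = (-socle n + v.1, v.2) := by
  obtain ⟨y, s⟩ := v
  have hs : s + 1 + 1 + 1 = s := by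
    revert s
    decide
  have hy : act n (act n (act n y)) = y := by
    have h1 := act_norm y
    have h2 := act_norm (act n y)
    calc
      _ = act n (act n (act n y)) + act n (act n y) + act n y -
            (act n (act n y) + act n y + y) + y := by abel
      _ = y := by rw [h1, h2, sub_zero, zero_add]
  have hP : act n (act n (presocleHom hn s)) + act n (presocleHom hn s) + presocleHom hn s = 0 :=
    act_norm _
  have hu := three_nsmul_presocle hn
  refine Prod.ext ?_ hs
  simp only [affineMap, map_sub, map_add, presocleHom_one, hy, ← act_presocle]
  calc
    _ = -(act n (presocle n) - presocle n) + y -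
          (act n (act n (presocleHom hn s)) + act n (presocleHom hn s) + presocleHom hn s) -
          3 • presocle n := by abel
    _ = _ := by rw [hP, hu, sub_zero, sub_zero]

theorem affineMap_bijective {n : ℕ} (hn : 4 ≤ n) : Function.Bijective (affineMap hn) := by
  have h : Function.Injective fun v => affineMap hn (affineMap hn (affineMap hn v)) := by
    intro v w h
    simp only [affineMap_iterate, Prod.mk.injEq, add_right_inj] at h
    exact Prod.ext h.1 h.2
  exact Finite.injective_iff_bijective.1 fun v w hvw => h (by simp only [hvw])

theorem T4.exists_hom_translation {n : ℕ} (hn : 4 ≤ n) :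
    ∃ f : T4 n →* Equiv.Perm (Base n × ZMod 3),
      f (PresentedGroup.of 1) = translation n (ofAdd (el n 1 0)) ∧
      f (PresentedGroup.of 2) = translation n (ofAdd (el n 0 1)) := by
  let α : Equiv.Perm (Base n × ZMod 3) := Equiv.ofBijective _ (affineMap_bijective hn)
  have hα : ∀ v, α v = affineMap hn v := fun v => rfl
  have hrel := T4Relations.of_base hn (translation n) α⁻¹ (fun x => ?_) ?_
  · obtain ⟨f, -, h1, h2, -⟩ := T4.exists_hom hn hrel
    exact ⟨f, h1, h2⟩
  · rw [inv_inv, mul_inv_eq_iff_eq_mul]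
    ext1 ⟨y, s⟩
    rw [Equiv.Perm.mul_apply, Equiv.Perm.mul_apply, hα, hα, translation_apply, affineMap,
      affineMap, translation_apply, map_add, add_sub_assoc]
  · rw [inv_pow, inv_eq_iff_eq_inv, ← map_inv, ← ofAdd_neg]
    ext1 ⟨y, s⟩
    simp only [pow_succ, pow_zero, one_mul, Equiv.Perm.mul_apply, hα]
    rw [affineMap_iterate, translation_apply]

/-- Elements of a group satisfying the relations of `T4 n` come from a homomorphism from the base
on which `a` acts by `act n` and has cube `socle n`. -/
theorem T4Relations.exists_baseHom {H : Type*} [Group H] {n : ℕ} (hn : 4 ≤ n) {α β γ δ : H}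
    (h : T4Relations n α β γ δ) : ∃ ι : Multiplicative (Base n) →* H,
      ι (ofAdd (el n 1 0)) = β ∧ ι (ofAdd (el n 0 1)) = γ ∧ ι (ofAdd (el n (-3) (-3))) = δ ∧
      (∀ x, α⁻¹ * ι (ofAdd x) * α = ι (ofAdd (act n x))) ∧ α ^ 3 = ι (ofAdd (socle n)) := by
  have hγβ : Commute γ β := gpComm_eq_one_iff.1 h.comm_c_b
  have hδβ : Commute δ β := gpComm_eq_one_iff.1 h.comm_d_b
  have hδγ : Commute δ γ := gpComm_eq_one_iff.1 h.comm_d_c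
  have hγ (k : ℕ) (hk : (n - 1) / 2 ≤ k) : γ ^ 3 ^ k = 1 :=
    orderOf_dvd_iff_pow_eq_one.1
      ((orderOf_dvd_of_pow_eq_one h.c_pow).trans (pow_dvd_pow 3 hk))
  have hβ : β ^ 3 ^ (n / 2) = 1 := by
    have h1 := congrArg (· ^ 3 ^ (n / 2 - 1)) h.b_cube
    have hc : Commute (β ^ 3 * δ) (γ ^ 3) :=
      (hγβ.symm.pow_pow 3 3).mul_left (hδγ.pow_right 3)
    simp only [hc.mul_pow, (hδβ.symm.pow_left 3).mul_pow, h.d_pow, one_pow, mul_one, ← pow_mul,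
      ← pow_succ'] at h1
    rwa [Nat.sub_add_cancel (by omega), hγ _ (by omega), mul_one] at h1
  let ι : Multiplicative (Base n) →* H := AddMonoidHom.toMultiplicativeLeft
    (ZMod.prodLift (B := Additive H) _ _ (.ofMul β) (.ofMul γ)
      (by rw [← ofMul_pow, hβ, ofMul_one]) (by rw [← ofMul_pow, h.c_pow, ofMul_one])
      (congrArg Additive.ofMul hγβ.symm.eq))
  have hι (i j : ℤ) : ι (ofAdd (el n i j)) = β ^ i * γ ^ j :=
    congrArg Additive.toMul (ZMod.prodLift_intCast _ _ _ _ _ _ _ i j)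
  have hβι : ι (ofAdd (el n 1 0)) = β := by simp [hι]
  have hγι : ι (ofAdd (el n 0 1)) = γ := by simp [hι]
  have hδι : ι (ofAdd (el n (-3) (-3))) = δ := by
    have h1 := h.b_cube
    rw [hδβ.symm.pow_left 3, mul_assoc] at h1
    rw [hι, eq_comm, eq_inv_of_mul_eq_one_left h1, mul_inv_rev, (hγβ.pow_pow 3 3).inv_inv,
      zpow_neg, zpow_neg]
    norm_cast
  refine ⟨ι, hβι, hγι, hδι, fun x => ?_, ?_⟩
  · have key : (MulAut.conj α⁻¹).toMonoidHom.comp ι = ι.comp (act n).toMultiplicative := by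
      refine monoidHom_ext ?_ ?_
      · change α⁻¹ * ι (ofAdd (el n 1 0)) * (α⁻¹)⁻¹ = ι (ofAdd (act n (el n 1 0)))
        rw [act_el, hι, hι, h.comm_b_a, gpComm]
        group
      · change α⁻¹ * ι (ofAdd (el n 0 1)) * (α⁻¹)⁻¹ = ι (ofAdd (act n (el n 0 1)))
        have h1 : α⁻¹ * γ * (α⁻¹)⁻¹ = γ * δ := by
          rw [h.comm_c_a, gpComm]
          group
        rw [hγι, h1, act_el, ← hγι, ← hδι, ← map_mul, ← ofAdd_add, el_add]
        norm_num
    have := DFunLike.congr_fun key (ofAdd x)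
    simpa using this
  · rw [h.a_cube, socle]
    split_ifs
    · rw [ofAdd_zsmul, map_zpow, hδι]
    · rw [ofAdd_zsmul, map_zpow, hγι]

theorem T4.exists_eq_mul {n : ℕ} {ι : Multiplicative (Base n) →* T4 n}
    (h1 : ι (ofAdd (el n 1 0)) = PresentedGroup.of 1)
    (h2 : ι (ofAdd (el n 0 1)) = PresentedGroup.of 2)
    (h3 : ι (ofAdd (el n (-3) (-3))) = PresentedGroup.of 3)
    (hconj : ∀ x, (PresentedGroup.of 0)⁻¹ * ι (ofAdd x) * PresentedGroup.of 0 = ι (ofAdd (act n x)))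
    (hcube : PresentedGroup.of 0 ^ 3 = ι (ofAdd (socle n))) (g : T4 n) :
    ∃ (k : ℤ) (x : Base n), g = PresentedGroup.of 0 ^ k * ι (ofAdd x) := by
  have ha (g : T4 n) (hg : ∃ (k : ℤ) (x : Base n), g = PresentedGroup.of 0 ^ k * ι (ofAdd x)) :
      ∃ (k : ℤ) (x : Base n), g * PresentedGroup.of 0 = PresentedGroup.of 0 ^ k * ι (ofAdd x) := by
    obtain ⟨k, x, rfl⟩ := hg
    exact ⟨k + 1, act n x, by rw [← hconj]; group⟩
  have hx (g : T4 n) (y) (hg : ∃ (k : ℤ) (x : Base n), g = PresentedGroup.of 0 ^ k * ι (ofAdd x)) :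
      ∃ (k : ℤ) (x : Base n), g * ι y = PresentedGroup.of 0 ^ k * ι (ofAdd x) := by
    obtain ⟨k, x, rfl⟩ := hg
    exact ⟨k, x + y.toAdd, by rw [ofAdd_add, map_mul, ofAdd_toAdd, mul_assoc]⟩
  have hinv : (PresentedGroup.of 0 : T4 n)⁻¹ =
      PresentedGroup.of 0 * PresentedGroup.of 0 * ι (ofAdd (socle n))⁻¹ := by
    rw [map_inv, ← hcube]
    group
  have hmem : g ∈ Subgroup.closure (Set.range (PresentedGroup.of : Fin 4 → T4 n)) := by
    rw [PresentedGroup.closure_range_of]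
    trivial
  induction hmem using Subgroup.closure_induction_right with
  | one => exact ⟨0, 0, by simp⟩
  | mul_right g _ y hy ih =>
    obtain ⟨i, rfl⟩ := hy
    fin_cases i
    · exact ha g ih
    · exact h1 ▸ hx g _ ih
    · exact h2 ▸ hx g _ ih
    · exact h3 ▸ hx g _ ih
  | mul_inv_cancel g _ y hy ih =>
    obtain ⟨i, rfl⟩ := hy
    fin_cases i
    · have := hx _ (ofAdd (socle n))⁻¹ (ha _ (ha g ih))
      rwa [mul_assoc, mul_assoc, ← mul_assoc (PresentedGroup.of 0), ← hinv] at this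
    · have := hx g (ofAdd (el n 1 0))⁻¹ ih
      rwa [map_inv, h1] at this
    · have := hx g (ofAdd (el n 0 1))⁻¹ ih
      rwa [map_inv, h2] at this
    · have := hx g (ofAdd (el n (-3) (-3)))⁻¹ ih
      rwa [map_inv, h3] at this

theorem T4.nonempty_maxClassExtension {n : ℕ} (hn : 4 ≤ n) :
    Nonempty (MaxClassExtension (T4 n) (Base n)) := by
  obtain ⟨ι, h1, h2, h3, hconj, hcube⟩ := (T4.relations n hn).exists_baseHom hn
  obtain ⟨ρ, hρ1, hρ2⟩ := T4.exists_hom_translation hn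
  have hρ : ρ.comp ι = translation n :=
    monoidHom_ext (by rw [MonoidHom.comp_apply, h1, hρ1]) (by rw [MonoidHom.comp_apply, h2, hρ2])
  have hsocle : fstMod hn (socle n) = 0 := by
    rw [← act_presocle, map_sub, fstMod_act, sub_self]
  obtain ⟨deg, hdeg0, hdeg1, hdeg2, -⟩ := T4.exists_hom hn
    (T4Relations.of_base hn 1 (ofAdd (1 : ZMod 3)) (by simp) (by simp; rfl))
  obtain ⟨χ, hχ0, hχ1, hχ2, -⟩ := T4.exists_hom hn
    (T4Relations.of_base hn (fstMod hn).toMultiplicative 1 (by simp [fstMod_act])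
      (by simp [hsocle]))
  have hdeg : deg.comp ι = 1 :=
    monoidHom_ext (by rw [MonoidHom.comp_apply, h1, hdeg1]) (by rw [MonoidHom.comp_apply, h2, hdeg2])
  have hχ : χ.comp ι = (fstMod hn).toMultiplicative :=
    monoidHom_ext (by rw [MonoidHom.comp_apply, h1, hχ1]) (by rw [MonoidHom.comp_apply, h2, hχ2])
  refine ⟨{
    ι := ι
    ι_injective := fun x y hxy => translation_injective n (by
      rw [← hρ, MonoidHom.comp_apply, hxy, MonoidHom.comp_apply])
    deg := deg
    deg_ker := ?_
    a := PresentedGroup.of 0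
    deg_a := hdeg0
    σ := act n
    conj_a := hconj
    σ_norm := act_norm
    z := socle n
    a_cube := hcube
    z_ne_zero := socle_ne_zero hn
    π₁ := fstMod hn
    π₂ := sndMod hn
    π_surjective := exists_mod_eq hn
    π_ker := exists_three_nsmul_eq hn
    π₁_σ := fstMod_act hn
    π₁_ker := exists_act_sub_eq hn
    χ := χ
    χ_a := hχ0
    χ_ι := fun x => DFunLike.congr_fun hχ (ofAdd x) }⟩
  refine le_antisymm (fun g hg => ?_) ?_
  · obtain ⟨k, x, rfl⟩ := T4.exists_eq_mul h1 h2 h3 hconj hcube g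
    have hx : deg (ι (ofAdd x)) = 1 := DFunLike.congr_fun hdeg (ofAdd x)
    rw [MonoidHom.mem_ker, map_mul, hx, mul_one, map_zpow, hdeg0, ← ofAdd_zsmul, ofAdd_eq_one,
      zsmul_one, ZMod.intCast_zmod_eq_zero_iff_dvd] at hg
    obtain ⟨l, rfl⟩ := hg
    refine mul_mem ?_ ⟨_, rfl⟩
    rw [zpow_mul]
    exact zpow_mem (MonoidHom.mem_range.2 ⟨_, hcube.symm⟩) l
  · rintro _ ⟨x, rfl⟩
    exact DFunLike.congr_fun hdeg x

theorem Base.natCard {n : ℕ} (hn : 4 ≤ n) : Nat.card (Base n) = 3 ^ (n - 2 + 1) := by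
  rw [Nat.card_prod, Nat.card_zmod, Nat.card_zmod, ← pow_add]
  congr 1
  omega

end MaxClass3

open MaxClass3 in
/-- For `n ≥ 4`, the group `T4(n)` satisfies `S(T4(n)) = 10 + 2·3^{n-2}`. -/
theorem SInvariant_T4 (n : ℕ) (hn : 4 ≤ n) :
    SInvariant (T4 n) = 10 + 2 * 3 ^ (n - 2) := by
  obtain ⟨E⟩ := T4.nonempty_maxClassExtension hn
  exact E.SInvariant_eq (Base.natCard hn)
end

section
/- Let m ≥ 1 be an integer and let G be the group presented on generators a, b subject to the relations [b,a]^{2^m} = 1, [[b,a],a] = 1, [[b,a],b] = 1, a^{2^m} = [b,a]^{2^{m−1}}, b^{2^m} = [b,a]^{2^{m−1}}. Then the center of G equals the derived subgroup of G, and G/Z(G) is isomorphic to the direct product of two cyclic groups of order 2^m. -/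
namespace ClassTwoCase1

/-- The free generators `a` and `b`. -/
abbrev a : FreeGroup (Fin 2) := FreeGroup.of 0
abbrev b : FreeGroup (Fin 2) := FreeGroup.of 1

/-- Relators of `G`: `[b,a]^{2^m} = [[b,a],a] = [[b,a],b] = 1`,
`a^{2^m} = [b,a]^{2^{m-1}}`, `b^{2^m} = [b,a]^{2^{m-1}}`. -/
def Grels (m : ℕ) : Set (FreeGroup (Fin 2)) :=
  {gpComm b a ^ 2 ^ m, gpComm (gpComm b a) a, gpComm (gpComm b a) b,
    a ^ 2 ^ m * (gpComm b a ^ 2 ^ (m - 1))⁻¹, b ^ 2 ^ m * (gpComm b a ^ 2 ^ (m - 1))⁻¹}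

/-- The presented group `G`. -/
abbrev G (m : ℕ) : Type := PresentedGroup (Grels m)

end ClassTwoCase1

namespace ClassTwoCase1

section General

variable {H K : Type*} [Group H] [Group K]

theorem map_gpComm (f : H →* K) (x y : H) : f (gpComm x y) = gpComm (f x) (f y) := by
  simp [gpComm]

theorem gpComm_eq_iff {x y z : H} : gpComm x y = z ↔ x * y = y * x * z := by
  rw [gpComm, ← mul_right_inj (y * x)]
  simp [mul_assoc]

theorem gpComm_mem_commutator (x y : H) : gpComm x y ∈ commutator H := by
  have h := Subgroup.commutator_mem_commutator (Subgroup.mem_top x⁻¹) (Subgroup.mem_top y⁻¹)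
  simpa [commutatorElement_def, gpComm, commutator_def] using h

theorem gpComm_eq_one_iff {x y : H} : gpComm x y = 1 ↔ Commute x y := by
  rw [gpComm_eq_iff, mul_one]; rfl

variable {u v c : H}

theorem zpow_mul_left_gen (hcv : Commute c v) (h : v * u = u * v * c) (j : ℤ) :
    v ^ j * u = u * (v ^ j * c ^ j) := by
  have hs : SemiconjBy u (v * c) v := by rw [SemiconjBy, h, mul_assoc]
  rw [← hcv.symm.mul_zpow]
  exact (hs.zpow_right j).eq.symm

theorem right_gen_mul_zpow (hcu : Commute c u) (hcv : Commute c v) (h : v * u = u * v * c)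
    (i : ℤ) : v * u ^ i = u ^ i * c ^ i * v := by
  have hs : SemiconjBy v u (u * c) := by rw [SemiconjBy, h, mul_assoc, mul_assoc, hcv.eq]
  rw [← hcu.symm.mul_zpow]
  exact (hs.zpow_right i).eq

theorem exists_normal_form (hcu : Commute c u) (hcv : Commute c v) (h : v * u = u * v * c)
    (hgen : Subgroup.closure {u, v} = ⊤) (g : H) :
    ∃ i j k : ℤ, g = u ^ i * v ^ j * c ^ k := by
  have hg : g ∈ Subgroup.closure {u, v} := hgen ▸ Subgroup.mem_top g
  induction hg using Subgroup.closure_induction_right with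
  | one => exact ⟨0, 0, 0, by simp⟩
  | mul_right x _ y hy ih =>
    obtain ⟨i, j, k, rfl⟩ := ih
    rcases hy with rfl | rfl
    · refine ⟨i + 1, j, j + k, ?_⟩
      rw [mul_assoc _ (c ^ k), (hcu.zpow_left k).eq, ← mul_assoc, mul_assoc _ _ y,
        zpow_mul_left_gen hcv h, zpow_add, zpow_add, zpow_one]
      simp only [mul_assoc]
    · refine ⟨i, j + 1, k, ?_⟩
      rw [mul_assoc _ (c ^ k), (hcv.zpow_left k).eq, zpow_add, zpow_one]
      simp only [mul_assoc]
  | mul_inv_cancel x _ y hy ih =>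
    obtain ⟨i, j, k, rfl⟩ := ih
    rcases hy with rfl | rfl
    · refine ⟨i - 1, j, k - j, ?_⟩
      have key := zpow_mul_left_gen hcv h j
      rw [mul_inv_eq_iff_eq_mul, mul_assoc _ (c ^ (k - j)), (hcu.zpow_left _).eq,
        ← mul_assoc, mul_assoc _ _ y, key, zpow_sub_one]
      simp only [mul_assoc, inv_mul_cancel_left]
      rw [← zpow_add, add_sub_cancel]
    · refine ⟨i, j - 1, k, ?_⟩
      rw [mul_inv_eq_iff_eq_mul, mul_assoc _ (c ^ k), (hcv.zpow_left k).eq, zpow_sub_one]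
      simp only [mul_assoc, inv_mul_cancel_left]

theorem zpow_eq_one_of_central (hcu : Commute c u) (hcv : Commute c v) (h : v * u = u * v * c)
    {i j k : ℤ} (hg : u ^ i * v ^ j * c ^ k ∈ Subgroup.center H) :
    c ^ i = 1 ∧ c ^ j = 1 := by
  rw [Subgroup.mem_center_iff] at hg
  constructor
  · have hv := hg v
    rw [← mul_assoc, ← mul_assoc, right_gen_mul_zpow hcu hcv h, mul_assoc _ (c ^ k),
      (hcv.zpow_left k).eq] at hv
    have hvj := ((Commute.refl v).zpow_right j).eq
    simp only [mul_assoc, mul_right_inj] at hv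
    rw [← mul_assoc v, ← mul_assoc (v ^ j) v, hvj] at hv
    simpa using hv
  · have hu := hg u
    rw [mul_assoc _ (c ^ k), (hcu.zpow_left k).eq, ← mul_assoc (_ * _) u, mul_assoc _ _ u,
      zpow_mul_left_gen hcv h] at hu
    rw [← mul_assoc, ← mul_assoc, ← mul_assoc, ← mul_assoc,
      ((Commute.refl u).zpow_right i).eq] at hu
    simp only [mul_assoc, mul_right_inj] at hu
    simpa using hu

end General

section Monomial

theorem zmultiplesHom_two_natCast (N : ℕ) :
    zmultiplesHom (ZMod (2 * N)) 2 (N : ℤ) = 0 := by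
  have h := ZMod.natCast_self (2 * N)
  rw [Nat.cast_mul, Nat.cast_ofNat, mul_comm (2 : ZMod (2 * N))] at h
  simpa using h

/-- The homomorphism `ℤ/N → ℤ/2N` given by doubling. -/
def double (N : ℕ) : ZMod N →+ ZMod (2 * N) :=
  ZMod.lift N ⟨zmultiplesHom _ 2, zmultiplesHom_two_natCast N⟩

theorem double_one (N : ℕ) : double N 1 = 2 := by
  simpa [double] using ZMod.lift_coe N ⟨zmultiplesHom _ 2, zmultiplesHom_two_natCast N⟩ 1

/-- The monomial shift: translate the position and the phase by one. -/
def shift (N : ℕ) : Equiv.Perm (ZMod N × ZMod (2 * N)) where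
  toFun p := (p.1 + 1, p.2 + 1)
  invFun p := (p.1 - 1, p.2 - 1)
  left_inv p := by simp
  right_inv p := by simp

/-- The monomial clock: translate the phase according to the position. -/
def clock (N : ℕ) : Equiv.Perm (ZMod N × ZMod (2 * N)) where
  toFun p := (p.1, p.2 + (1 + double N p.1))
  invFun p := (p.1, p.2 - (1 + double N p.1))
  left_inv p := by simp
  right_inv p := by simp

/-- The scalar that translates the phase by two. -/
def scalar (N : ℕ) : Equiv.Perm (ZMod N × ZMod (2 * N)) where
  toFun p := (p.1, p.2 + 2)
  invFun p := (p.1, p.2 - 2)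
  left_inv p := by simp
  right_inv p := by simp

theorem shift_pow_apply (N n : ℕ) (p) : (shift N ^ n) p = (p.1 + n, p.2 + n) := by
  induction n with
  | zero => simp
  | succ n ih => rw [pow_succ', Equiv.Perm.mul_apply, ih]; simp [shift, add_assoc]

theorem clock_pow_apply (N n : ℕ) (p) :
    (clock N ^ n) p = (p.1, p.2 + n * (1 + double N p.1)) := by
  induction n with
  | zero => simp
  | succ n ih =>
    rw [pow_succ', Equiv.Perm.mul_apply, ih]
    simp only [clock, Equiv.coe_fn_mk, Nat.cast_succ, Prod.mk.injEq, true_and]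
    ring

theorem scalar_pow_apply (N n : ℕ) (p) : (scalar N ^ n) p = (p.1, p.2 + n * 2) := by
  induction n with
  | zero => simp
  | succ n ih =>
    rw [pow_succ', Equiv.Perm.mul_apply, ih]
    simp only [scalar, Equiv.coe_fn_mk, Nat.cast_succ, Prod.mk.injEq, true_and]
    ring

theorem natCast_mul_double (N : ℕ) (x : ZMod N) : (N : ZMod (2 * N)) * double N x = 0 := by
  rw [← nsmul_eq_mul, ← map_nsmul, nsmul_eq_mul, ZMod.natCast_self, zero_mul, map_zero]

theorem gpComm_clock_shift (N : ℕ) : gpComm (clock N) (shift N) = scalar N := by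
  rw [gpComm_eq_iff]
  ext1 p
  simp only [Equiv.Perm.mul_apply, clock, shift, scalar, Equiv.coe_fn_mk, map_add, double_one,
    Prod.mk.injEq, true_and]
  ring

theorem commute_scalar_shift (N : ℕ) : Commute (scalar N) (shift N) := by
  ext1 p
  simp [scalar, shift, add_right_comm]

theorem commute_scalar_clock (N : ℕ) : Commute (scalar N) (clock N) := by
  ext1 p
  simp [scalar, clock, add_right_comm]

theorem scalar_pow_eq_one_iff {N : ℕ} (n : ℕ) : scalar N ^ n = 1 ↔ N ∣ n := by
  have h2 : (n : ZMod (2 * N)) * 2 = 0 ↔ N ∣ n := by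
    have h := ZMod.natCast_eq_zero_iff (2 * n) (2 * N)
    rwa [Nat.mul_dvd_mul_iff_left two_pos, Nat.cast_mul, Nat.cast_ofNat,
      mul_comm (2 : ZMod (2 * N))] at h
  rw [← h2]
  constructor
  · intro h
    simpa [scalar_pow_apply] using congrArg Prod.snd (DFunLike.congr_fun h (0, 0))
  · intro h
    ext1 p
    simp [scalar_pow_apply, h]

theorem shift_pow_self {N M : ℕ} (h : M * 2 = N) : shift N ^ N = scalar N ^ M := by
  ext1 p
  rw [shift_pow_apply, scalar_pow_apply, ZMod.natCast_self, add_zero]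
  congr 2
  exact_mod_cast congrArg (Nat.cast : ℕ → ZMod (2 * N)) h.symm

theorem clock_pow_self {N M : ℕ} (h : M * 2 = N) : clock N ^ N = scalar N ^ M := by
  ext1 p
  rw [clock_pow_apply, scalar_pow_apply, mul_add, mul_one, natCast_mul_double, add_zero]
  congr 2
  exact_mod_cast congrArg (Nat.cast : ℕ → ZMod (2 * N)) h.symm

end Monomial

section Presentation

variable {m : ℕ} {H : Type*} [Group H]

/-- The homomorphism from `G m` determined by a pair of elements satisfying the relations. -/
def homOfRelations (u v c : H) (hc : gpComm v u = c) (hcN : c ^ 2 ^ m = 1)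
    (hcu : Commute c u) (hcv : Commute c v) (hu : u ^ 2 ^ m = c ^ 2 ^ (m - 1))
    (hv : v ^ 2 ^ m = c ^ 2 ^ (m - 1)) : G m →* H :=
  PresentedGroup.toGroup (f := ![u, v]) (rels := Grels m) (by
    rintro r (rfl | rfl | rfl | rfl | rfl) <;>
      simp [map_gpComm, hc, hcN, hu, hv, gpComm_eq_one_iff, hcu, hcv])

variable (m) in
/-- The image of `a` in `G m`. -/
abbrev genA : G m := PresentedGroup.of 0

variable (m) in
/-- The image of `b` in `G m`. -/
abbrev genB : G m := PresentedGroup.of 1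

variable (m) in
/-- The image of `[b,a]` in `G m`. -/
abbrev genC : G m := gpComm (genB m) (genA m)

theorem mk_rel_eq_one {r : FreeGroup (Fin 2)} (hr : r ∈ Grels m) :
    PresentedGroup.mk (Grels m) r = 1 :=
  (PresentedGroup.mk_eq_one_iff).2 (Subgroup.subset_normalClosure hr)

theorem genC_pow : genC m ^ 2 ^ m = 1 := by
  have h := mk_rel_eq_one (m := m) (r := gpComm b a ^ 2 ^ m) (by simp [Grels])
  rwa [map_pow, map_gpComm] at h

theorem commute_genC_genA : Commute (genC m) (genA m) := by
  have h := mk_rel_eq_one (m := m) (r := gpComm (gpComm b a) a) (by simp [Grels])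
  rwa [map_gpComm, map_gpComm, gpComm_eq_one_iff] at h

theorem commute_genC_genB : Commute (genC m) (genB m) := by
  have h := mk_rel_eq_one (m := m) (r := gpComm (gpComm b a) b) (by simp [Grels])
  rwa [map_gpComm, map_gpComm, gpComm_eq_one_iff] at h

theorem genA_pow : genA m ^ 2 ^ m = genC m ^ 2 ^ (m - 1) := by
  have h := mk_rel_eq_one (m := m) (r := a ^ 2 ^ m * (gpComm b a ^ 2 ^ (m - 1))⁻¹)
    (by simp [Grels])
  rwa [map_mul, map_inv, map_pow, map_pow, map_gpComm, mul_inv_eq_one] at h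

theorem genB_pow : genB m ^ 2 ^ m = genC m ^ 2 ^ (m - 1) := by
  have h := mk_rel_eq_one (m := m) (r := b ^ 2 ^ m * (gpComm b a ^ 2 ^ (m - 1))⁻¹)
    (by simp [Grels])
  rwa [map_mul, map_inv, map_pow, map_pow, map_gpComm, mul_inv_eq_one] at h

theorem genB_mul_genA : genB m * genA m = genA m * genB m * genC m :=
  gpComm_eq_iff.1 rfl

theorem closure_gens : Subgroup.closure {genA m, genB m} = ⊤ := by
  rw [← PresentedGroup.closure_range_of (Grels m)]
  congr 1
  ext x
  simp [Fin.exists_fin_two, eq_comm]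

theorem normal_form (g : G m) : ∃ i j k : ℤ, g = genA m ^ i * genB m ^ j * genC m ^ k :=
  exists_normal_form commute_genC_genA commute_genC_genB genB_mul_genA closure_gens g

theorem orderOf_genC (hm : 1 ≤ m) : orderOf (genC m) = 2 ^ m := by
  have hM : 2 ^ (m - 1) * 2 = 2 ^ m := by rw [← pow_succ, Nat.sub_add_cancel hm]
  refine Nat.dvd_antisymm (orderOf_dvd_of_pow_eq_one genC_pow) ?_
  let φ : G m →* _ := homOfRelations (shift (2 ^ m)) (clock (2 ^ m)) (scalar (2 ^ m))
    (gpComm_clock_shift _) ((scalar_pow_eq_one_iff _).2 dvd_rfl) (commute_scalar_shift _)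
    (commute_scalar_clock _) (shift_pow_self hM) (clock_pow_self hM)
  have hφ : φ (genC m) = scalar (2 ^ m) := by
    rw [map_gpComm]
    simp [φ, homOfRelations, gpComm_clock_shift]
  rw [← scalar_pow_eq_one_iff, ← hφ, ← map_pow, pow_orderOf_eq_one, map_one]

theorem mem_zpowers_genC {i j : ℤ} (k : ℤ) (hi : ((2 ^ m : ℕ) : ℤ) ∣ i)
    (hj : ((2 ^ m : ℕ) : ℤ) ∣ j) :
    genA m ^ i * genB m ^ j * genC m ^ k ∈ Subgroup.zpowers (genC m) := by
  obtain ⟨i, rfl⟩ := hi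
  obtain ⟨j, rfl⟩ := hj
  rw [zpow_mul, zpow_mul, zpow_natCast, zpow_natCast, genA_pow, genB_pow]
  have hc := Subgroup.mem_zpowers (genC m)
  exact mul_mem (mul_mem (zpow_mem (pow_mem hc _) _) (zpow_mem (pow_mem hc _) _)) (zpow_mem hc _)

variable (m) in
/-- The homomorphism recording the exponents of `a` and `b` modulo `2 ^ m`. -/
def exponents : G m →* Multiplicative (ZMod (2 ^ m)) × Multiplicative (ZMod (2 ^ m)) :=
  homOfRelations (Multiplicative.ofAdd 1, 1) (1, Multiplicative.ofAdd 1) 1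
    (by simp [gpComm]) (one_pow _) (Commute.one_left _) (Commute.one_left _)
    (by ext <;> simp [← ofAdd_nsmul])
    (by ext <;> simp [← ofAdd_nsmul])

theorem exponents_normal_form (i j k : ℤ) :
    exponents m (genA m ^ i * genB m ^ j * genC m ^ k) =
      (Multiplicative.ofAdd (i : ZMod (2 ^ m)), Multiplicative.ofAdd (j : ZMod (2 ^ m))) := by
  simp [exponents, homOfRelations, gpComm, ← ofAdd_zsmul]

theorem exponents_surjective : Function.Surjective (exponents m) := by
  rintro ⟨x, y⟩
  obtain ⟨i, hi⟩ := ZMod.intCast_surjective x.toAdd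
  obtain ⟨j, hj⟩ := ZMod.intCast_surjective y.toAdd
  exact ⟨_, (exponents_normal_form i j 0).trans (by rw [hi, hj]; rfl)⟩

theorem ker_exponents_le : (exponents m).ker ≤ Subgroup.zpowers (genC m) := by
  intro g hg
  obtain ⟨i, j, k, rfl⟩ := normal_form g
  rw [MonoidHom.mem_ker, exponents_normal_form, Prod.mk_eq_one, ofAdd_eq_one, ofAdd_eq_one,
    ZMod.intCast_zmod_eq_zero_iff_dvd, ZMod.intCast_zmod_eq_zero_iff_dvd] at hg
  exact mem_zpowers_genC k hg.1 hg.2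

theorem zpowers_genC_le_commutator : Subgroup.zpowers (genC m) ≤ commutator (G m) :=
  Subgroup.zpowers_le.2 (gpComm_mem_commutator _ _)

theorem commutator_le_ker_exponents : commutator (G m) ≤ (exponents m).ker :=
  Abelianization.commutator_subset_ker _

theorem zpowers_genC_le_center : Subgroup.zpowers (genC m) ≤ Subgroup.center (G m) := by
  rw [Subgroup.zpowers_le, Subgroup.mem_center_iff]
  intro g
  obtain ⟨i, j, k, rfl⟩ := normal_form g
  exact (((commute_genC_genA.zpow_right i).mul_right (commute_genC_genB.zpow_right j)).mul_right
    ((Commute.refl _).zpow_right k)).eq.symm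

theorem center_le_zpowers_genC (hm : 1 ≤ m) :
    Subgroup.center (G m) ≤ Subgroup.zpowers (genC m) := by
  intro g hg
  obtain ⟨i, j, k, rfl⟩ := normal_form g
  obtain ⟨hi, hj⟩ := zpow_eq_one_of_central commute_genC_genA commute_genC_genB genB_mul_genA hg
  rw [← orderOf_dvd_iff_zpow_eq_one, orderOf_genC hm] at hi hj
  exact mem_zpowers_genC k hi hj

end Presentation

end ClassTwoCase1

open ClassTwoCase1 in
/-- For the group `G` above, `Z(G) = G'` and `G/Z(G) ≅ C_{2^m} × C_{2^m}`. -/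
theorem center_eq_commutator_case1 (m : ℕ) (hm : 1 ≤ m) :
    Subgroup.center (G m) = commutator (G m) ∧
      Nonempty ((G m ⧸ Subgroup.center (G m)) ≃*
        (Multiplicative (ZMod (2 ^ m)) × Multiplicative (ZMod (2 ^ m)))) := by
  have hcomm : Subgroup.center (G m) = commutator (G m) :=
    le_antisymm ((center_le_zpowers_genC hm).trans zpowers_genC_le_commutator)
      ((commutator_le_ker_exponents.trans ker_exponents_le).trans zpowers_genC_le_center)
  have hker : Subgroup.center (G m) = (exponents m).ker :=
    le_antisymm (hcomm.trans_le commutator_le_ker_exponents)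
      (ker_exponents_le.trans zpowers_genC_le_center)
  exact ⟨hcomm, ⟨(QuotientGroup.quotientMulEquivOfEq hker).trans
    (QuotientGroup.quotientKerEquivOfSurjective _ exponents_surjective)⟩⟩
end

section
/- Let m ≥ 1 be an integer and let H be the group presented on generators x, y subject to the relations [y,x]^{2^m} = 1, [[y,x],x] = 1, [[y,x],y] = 1, x^{2^m} = [y,x]^{2^{m−1}}, y^{2^m} = 1. Then the center of H equals the derived subgroup of H, and H/Z(H) is isomorphic to the direct product of two cyclic groups of order 2^m. -/
namespace ClassTwoCase2

/-- The free generators `x` and `y`. -/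
abbrev x : FreeGroup (Fin 2) := FreeGroup.of 0
abbrev y : FreeGroup (Fin 2) := FreeGroup.of 1

/-- Relators of `H`: `[y,x]^{2^m} = [[y,x],x] = [[y,x],y] = 1`,
`x^{2^m} = [y,x]^{2^{m-1}}`, `y^{2^m} = 1`. -/
def Hrels (m : ℕ) : Set (FreeGroup (Fin 2)) :=
  {gpComm y x ^ 2 ^ m, gpComm (gpComm y x) x, gpComm (gpComm y x) y,
    x ^ 2 ^ m * (gpComm y x ^ 2 ^ (m - 1))⁻¹, y ^ 2 ^ m}

/-- The presented group `H`. -/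
abbrev H (m : ℕ) : Type := PresentedGroup (Hrels m)

end ClassTwoCase2

/-- The Heisenberg group over `R`: the triple `(a, b, c)` stands for the upper unitriangular
matrix with entries `a`, `b` above the diagonal and `c` in the corner. -/
@[ext]
structure Heisenberg (R : Type*) where
  /-- The entry in position `(1, 2)`. -/
  a : R
  /-- The entry in position `(2, 3)`. -/
  b : R
  /-- The entry in position `(1, 3)`. -/
  c : R

namespace Heisenberg

variable {R : Type*} [CommRing R]

instance : Mul (Heisenberg R) := ⟨fun g h => ⟨g.a + h.a, g.b + h.b, g.c + h.c + g.a * h.b⟩⟩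

instance : One (Heisenberg R) := ⟨⟨0, 0, 0⟩⟩

instance : Inv (Heisenberg R) := ⟨fun g => ⟨-g.a, -g.b, -g.c + g.a * g.b⟩⟩

@[simp] theorem mul_a (g h : Heisenberg R) : (g * h).a = g.a + h.a := rfl
@[simp] theorem mul_b (g h : Heisenberg R) : (g * h).b = g.b + h.b := rfl
@[simp] theorem mul_c (g h : Heisenberg R) : (g * h).c = g.c + h.c + g.a * h.b := rfl
@[simp] theorem one_a : (1 : Heisenberg R).a = 0 := rfl
@[simp] theorem one_b : (1 : Heisenberg R).b = 0 := rfl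
@[simp] theorem one_c : (1 : Heisenberg R).c = 0 := rfl
@[simp] theorem inv_a (g : Heisenberg R) : g⁻¹.a = -g.a := rfl
@[simp] theorem inv_b (g : Heisenberg R) : g⁻¹.b = -g.b := rfl
@[simp] theorem inv_c (g : Heisenberg R) : g⁻¹.c = -g.c + g.a * g.b := rfl

instance : Group (Heisenberg R) :=
  Group.ofLeftAxioms
    (fun g h k => by ext <;> simp <;> ring)
    (fun g => by ext <;> simp)
    (fun g => by ext <;> simp)

theorem pow_eq (g : Heisenberg R) (n : ℕ) :
    g ^ n = ⟨n * g.a, n * g.b, n * g.c + n.choose 2 * (g.a * g.b)⟩ := by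
  induction n with
  | zero => ext <;> simp
  | succ n ih =>
    rw [pow_succ, ih]
    ext <;> simp [Nat.choose_succ_succ n 1] <;> ring

/-- The image of a unitriangular matrix in the abelianization. -/
def toProd : Heisenberg R →* Multiplicative R × Multiplicative R where
  toFun g := (Multiplicative.ofAdd g.a, Multiplicative.ofAdd g.b)
  map_one' := rfl
  map_mul' _ _ := rfl

end Heisenberg

theorem map_gpComm {G G' : Type*} [Group G] [Group G'] (f : G →* G') (g h : G) :
    f (gpComm g h) = gpComm (f g) (f h) := by
  simp [gpComm]

theorem gpComm_eq_one_iff_commute {G : Type*} [Group G] {g h : G} :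
    gpComm g h = 1 ↔ Commute g h := by
  rw [gpComm, mul_assoc, ← mul_inv_rev, inv_mul_eq_one, eq_comm, Commute, SemiconjBy]

theorem gpComm_mem_commutator {G : Type*} [Group G] (g h : G) : gpComm g h ∈ commutator G := by
  have := Subgroup.commutator_mem_commutator (Subgroup.mem_top g⁻¹) (Subgroup.mem_top h⁻¹)
  simpa [gpComm, commutatorElement_def, commutator_def] using this

theorem mem_center_of_commute_of_closure_eq_top {G : Type*} [Group G] {s : Set G}
    (hs : Subgroup.closure s = ⊤) {z : G} (hz : ∀ g ∈ s, Commute z g) :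
    z ∈ Subgroup.center G := by
  rw [← Subgroup.centralizer_univ, ← Subgroup.coe_top, ← hs, Subgroup.centralizer_closure]
  simpa [Subgroup.mem_iInf, Subgroup.mem_centralizer_iff] using fun g hg => (hz g hg).symm.eq

/-- Normal form in a two-generator group whose generators have central commutator. -/
theorem exists_eq_zpow_mul_zpow_mul_zpow {G : Type*} [Group G] {a b : G}
    (hab : Subgroup.closure {a, b} = ⊤) (hc : gpComm b a ∈ Subgroup.center G) (g : G) :
    ∃ i j k : ℤ, g = a ^ i * b ^ j * gpComm b a ^ k := by
  set c := gpComm b a with hcdef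
  have hcomm (z : G) : Commute z c := Subgroup.mem_center_iff.1 hc z
  have hconj : b * a * b⁻¹ = a * c := by
    rw [mul_inv_eq_iff_eq_mul, mul_assoc, ← (hcomm b).eq, hcdef, gpComm]
    group
  have hconj' : b⁻¹ * a * b = a * c⁻¹ := by
    rw [eq_mul_inv_iff_mul_eq, mul_assoc _ b, (hcomm b).eq, ← mul_assoc, mul_assoc b⁻¹, ← hconj]
    group
  have hpow (i : ℤ) : b * a ^ i = a ^ i * b * c ^ i := by
    rw [mul_inv_eq_iff_eq_mul.1 (conj_zpow (a := b) (b := a) (i := i)).symm, hconj,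
      (hcomm a).mul_zpow, mul_assoc, mul_assoc, ((hcomm b).zpow_right i).eq]
  have hpow' (i : ℤ) : b⁻¹ * a ^ i = a ^ i * b⁻¹ * c ^ (-i) := by
    have h := conj_zpow (a := b⁻¹) (b := a) (i := i)
    rw [inv_inv, hconj', (hcomm a).inv_right.mul_zpow, inv_zpow, ← zpow_neg] at h
    rw [eq_mul_inv_iff_mul_eq.2 h.symm, mul_assoc, mul_assoc,
      ((hcomm b⁻¹).zpow_right (-i)).eq]
  have hg : g ∈ Subgroup.closure {a, b} := hab ▸ Subgroup.mem_top g
  induction hg using Subgroup.closure_induction_left with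
  | one => exact ⟨0, 0, 0, by simp⟩
  | mul_left s hs h _ ih =>
    obtain ⟨i, j, k, rfl⟩ := ih
    rcases hs with rfl | rfl
    · exact ⟨1 + i, j, k, by simp [zpow_add, mul_assoc]⟩
    · refine ⟨i, 1 + j, i + k, ?_⟩
      rw [← mul_assoc, ← mul_assoc, hpow, mul_assoc _ (c ^ i),
        (((hcomm (s ^ j)).zpow_right i).symm).eq]
      simp [zpow_add, mul_assoc]
  | inv_mul_cancel s hs h _ ih =>
    obtain ⟨i, j, k, rfl⟩ := ih
    rcases hs with rfl | rfl
    · exact ⟨-1 + i, j, k, by simp [zpow_add, mul_assoc]⟩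
    · refine ⟨i, -1 + j, -i + k, ?_⟩
      rw [← mul_assoc, ← mul_assoc, hpow', mul_assoc _ (c ^ (-i)),
        (((hcomm (s ^ j)).zpow_right (-i)).symm).eq]
      simp only [zpow_add, zpow_neg_one, mul_assoc]

theorem two_pow_choose_two_cast {m : ℕ} (hm : 1 ≤ m) :
    (((2 ^ m).choose 2 : ℕ) : ZMod (2 ^ m)) = -2 ^ (m - 1) := by
  obtain ⟨n, rfl⟩ := Nat.exists_eq_add_of_le' hm
  have h : (2 ^ (n + 1)).choose 2 = 2 ^ n * (2 ^ (n + 1) - 1) := by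
    rw [Nat.choose_two_right, pow_succ, mul_right_comm, Nat.mul_div_cancel _ two_pos]
  have h0 : ((2 ^ (n + 1) : ℕ) : ZMod (2 ^ (n + 1))) = 0 := ZMod.natCast_self _
  rw [h, Nat.cast_mul, Nat.cast_sub Nat.one_le_two_pow, h0]
  simp

namespace ClassTwoCase2

theorem closure_generators (m : ℕ) :
    Subgroup.closure {(PresentedGroup.of 0 : H m), PresentedGroup.of 1} = ⊤ := by
  rw [← PresentedGroup.closure_range_of (Hrels m)]
  congr 1
  ext g
  simp [Fin.exists_fin_two, eq_comm]

theorem mk_eq_one {m : ℕ} {r : FreeGroup (Fin 2)} (hr : r ∈ Hrels m) :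
    PresentedGroup.mk (Hrels m) r = 1 :=
  PresentedGroup.one_of_mem hr

theorem gpComm_mem_center (m : ℕ) :
    gpComm (PresentedGroup.of 1 : H m) (PresentedGroup.of 0) ∈ Subgroup.center (H m) := by
  have hx := mk_eq_one (m := m) (r := gpComm (gpComm y x) x) (by simp [Hrels])
  have hy := mk_eq_one (m := m) (r := gpComm (gpComm y x) y) (by simp [Hrels])
  simp only [map_gpComm, gpComm_eq_one_iff_commute] at hx hy
  refine mem_center_of_commute_of_closure_eq_top (closure_generators m) ?_
  rintro g (rfl | rfl)
  exacts [hx, hy]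

/-- The images of the generators in the Heisenberg group over `ℤ / 2 ^ m`. -/
def heisenbergGen (m : ℕ) : Fin 2 → Heisenberg (ZMod (2 ^ m)) :=
  ![⟨1, 1, 0⟩, ⟨0, 1, 0⟩]

theorem gpComm_heisenbergGen (m : ℕ) :
    gpComm (heisenbergGen m 1) (heisenbergGen m 0) = ⟨0, 0, -1⟩ := by
  ext <;> simp [gpComm, heisenbergGen]

theorem lift_heisenbergGen_eq_one {m : ℕ} (hm : 1 ≤ m) :
    ∀ r ∈ Hrels m, FreeGroup.lift (heisenbergGen m) r = 1 := by
  rintro r (rfl | rfl | rfl | rfl | rfl) <;>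
    simp only [map_mul, map_inv, map_pow, map_gpComm, FreeGroup.lift_apply_of,
      gpComm_heisenbergGen]
  · ext <;> simp [Heisenberg.pow_eq]
  · ext <;> simp [gpComm, heisenbergGen]
  · ext <;> simp [gpComm, heisenbergGen]
  · ext <;> simp [Heisenberg.pow_eq, heisenbergGen, two_pow_choose_two_cast hm]
  · ext <;> simp [Heisenberg.pow_eq, heisenbergGen]

/-- The representation of `H m` in the Heisenberg group over `ℤ / 2 ^ m`. -/
def toHeisenberg {m : ℕ} (hm : 1 ≤ m) : H m →* Heisenberg (ZMod (2 ^ m)) :=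
  PresentedGroup.toGroup (lift_heisenbergGen_eq_one hm)

@[simp]
theorem toHeisenberg_of {m : ℕ} (hm : 1 ≤ m) (i : Fin 2) :
    toHeisenberg hm (PresentedGroup.of i) = heisenbergGen m i :=
  PresentedGroup.toGroup.of _

/-- The projection of `H m` onto `C_{2 ^ m} × C_{2 ^ m}`. -/
def toProd {m : ℕ} (hm : 1 ≤ m) :
    H m →* Multiplicative (ZMod (2 ^ m)) × Multiplicative (ZMod (2 ^ m)) :=
  Heisenberg.toProd.comp (toHeisenberg hm)

theorem toProd_of_zero {m : ℕ} (hm : 1 ≤ m) :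
    toProd hm (PresentedGroup.of 0) = (Multiplicative.ofAdd 1, Multiplicative.ofAdd 1) := by
  simp [toProd, Heisenberg.toProd, heisenbergGen]

theorem toProd_of_one {m : ℕ} (hm : 1 ≤ m) :
    toProd hm (PresentedGroup.of 1) = (1, Multiplicative.ofAdd 1) := by
  simp [toProd, Heisenberg.toProd, heisenbergGen]

theorem toProd_zpow_mul_zpow {m : ℕ} (hm : 1 ≤ m) (i j : ℤ) :
    toProd hm (PresentedGroup.of 0 ^ i * PresentedGroup.of 1 ^ j) =
      (Multiplicative.ofAdd (i : ZMod (2 ^ m)),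
        Multiplicative.ofAdd ((i : ZMod (2 ^ m)) + j)) := by
  rw [map_mul, map_zpow, map_zpow, toProd_of_zero, toProd_of_one]
  simp [← ofAdd_zsmul, ofAdd_add]

theorem toProd_surjective {m : ℕ} (hm : 1 ≤ m) : Function.Surjective (toProd hm) := by
  rintro ⟨u, v⟩
  obtain ⟨i, hi⟩ := ZMod.intCast_surjective u.toAdd
  obtain ⟨j, hj⟩ := ZMod.intCast_surjective (v.toAdd - u.toAdd)
  exact ⟨_, (toProd_zpow_mul_zpow hm i j).trans (by simp [hi, hj])⟩

theorem ker_toProd_le_zpowers {m : ℕ} (hm : 1 ≤ m) :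
    (toProd hm).ker ≤
      Subgroup.zpowers (gpComm (PresentedGroup.of 1 : H m) (PresentedGroup.of 0)) := by
  intro g hg
  obtain ⟨i, j, k, rfl⟩ :=
    exists_eq_zpow_mul_zpow_mul_zpow (closure_generators m) (gpComm_mem_center m) g
  have hc : toProd hm (gpComm (PresentedGroup.of 1) (PresentedGroup.of 0)) = 1 := by
    rw [map_gpComm, gpComm_eq_one_iff_commute]
    exact Commute.all _ _
  rw [MonoidHom.mem_ker, map_mul, map_zpow _ (gpComm _ _), hc, one_zpow, mul_one,
    toProd_zpow_mul_zpow, Prod.mk_eq_one, ofAdd_eq_one, ofAdd_eq_one] at hg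
  obtain ⟨hi, hj⟩ := hg
  rw [hi, zero_add] at hj
  rw [ZMod.intCast_zmod_eq_zero_iff_dvd] at hi hj
  obtain ⟨i, rfl⟩ := hi
  obtain ⟨j, rfl⟩ := hj
  have hx := mk_eq_one (m := m) (r := x ^ 2 ^ m * (gpComm y x ^ 2 ^ (m - 1))⁻¹) (by simp [Hrels])
  have hy := mk_eq_one (m := m) (r := y ^ 2 ^ m) (by simp [Hrels])
  rw [map_mul, map_inv, mul_inv_eq_one, map_pow, map_pow, map_gpComm] at hx
  rw [map_pow] at hy
  change (PresentedGroup.of 0 : H m) ^ 2 ^ m =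
    gpComm (PresentedGroup.of 1) (PresentedGroup.of 0) ^ 2 ^ (m - 1) at hx
  change (PresentedGroup.of 1 : H m) ^ 2 ^ m = 1 at hy
  rw [zpow_mul, zpow_natCast, hx, zpow_mul, zpow_natCast, hy, one_zpow, mul_one]
  exact mul_mem (zpow_mem (pow_mem (Subgroup.mem_zpowers _) _) _)
    (zpow_mem (Subgroup.mem_zpowers _) _)

theorem center_le_ker_toProd {m : ℕ} (hm : 1 ≤ m) :
    Subgroup.center (H m) ≤ (toProd hm).ker := by
  intro z hz
  have h (i : Fin 2) := congrArg (fun g => (toHeisenberg hm g).c)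
    (Subgroup.mem_center_iff.1 hz (PresentedGroup.of i))
  have h0 := h 0
  have h1 := h 1
  simp only [map_mul, toHeisenberg_of, Heisenberg.mul_c, heisenbergGen, Matrix.cons_val_zero,
    Matrix.cons_val_one, zero_add, add_zero, one_mul, mul_one, zero_mul] at h0 h1
  have ha : (toHeisenberg hm z).a = 0 := by simpa using h1
  have hb : (toHeisenberg hm z).b = 0 := by simpa [ha] using h0
  simp [MonoidHom.mem_ker, toProd, Heisenberg.toProd, ha, hb]

end ClassTwoCase2

open ClassTwoCase2 in
/-- For the group `H` above, `Z(H) = H'` and `H/Z(H) ≅ C_{2^m} × C_{2^m}`. -/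
theorem center_eq_commutator_case2 (m : ℕ) (hm : 1 ≤ m) :
    Subgroup.center (H m) = commutator (H m) ∧
      Nonempty ((H m ⧸ Subgroup.center (H m)) ≃*
        (Multiplicative (ZMod (2 ^ m)) × Multiplicative (ZMod (2 ^ m)))) := by
  have hker := ker_toProd_le_zpowers hm
  have hcenter : Subgroup.center (H m) = (toProd hm).ker :=
    (center_le_ker_toProd hm).antisymm
      (hker.trans (Subgroup.zpowers_le.2 (gpComm_mem_center m)))
  have hcomm : commutator (H m) = (toProd hm).ker :=
    (Abelianization.commutator_subset_ker _).antisymm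
      (hker.trans (Subgroup.zpowers_le.2 (gpComm_mem_commutator _ _)))
  exact ⟨hcenter.trans hcomm.symm, ⟨(QuotientGroup.quotientMulEquivOfEq hcenter).trans
    (QuotientGroup.quotientKerEquivOfSurjective _ (toProd_surjective hm))⟩⟩
end
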